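/- Let A be an arbitrary group, H = A ∗ ℤ the free product of A with an infinite cyclic group generated by t, and p : H → ℤ the retraction with p(t) = 1 and p|_A trivial. Then for every w ∈ H with p(w) = 1 or p(w) = −1 and every integer m ≥ 2, the natural homomorphism A → H/⟪w^m⟫ induced by the inclusion A → H is injective, where ⟪w^m⟫ is the normal closure of w^m in H. -/

import Mathlib

open Monoid Coprod

/-- The retraction `A ∗ ℤ → ℤ` killing `A`. -/
noncomputable def freeProdProj (A : Type) [Group A] :
    (A ∗ Multiplicative ℤ) →* Multiplicative ℤ :=
  Coprod.lift 1 (MonoidHom.id (Multiplicative ℤ))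

set_option linter.unusedSectionVars false
set_option linter.unusedSimpArgs false
set_option linter.unusedVariables false
namespace Pf
open Equiv Equiv.Perm

variable {D A : Type} [Group A]

/-- triviality of the label of the cycle through `d` -/
def Triv (σ : Perm D) (c : D → A) (d : D) : Prop :=
  ∃ g : D → A, ∀ e, σ.SameCycle d e → g (σ e) = g e * c e

/-- functions constant on cycles, supported on trivially labelled cycles -/
def T (σ : Perm D) (c : D → A) : Submodule ℚ (D → ℚ) where
  carrier := {f | (∀ d, f (σ d) = f d) ∧ ∀ d, f d ≠ 0 → Triv σ c d}
  add_mem' := by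
    rintro f g ⟨hf, hf'⟩ ⟨hg, hg'⟩
    refine ⟨fun d => by simp [hf, hg], fun d hd => ?_⟩
    by_cases h : f d = 0
    · apply hg'
      intro h2
      exact hd (by simp [h, h2])
    · exact hf' d h
  zero_mem' := ⟨fun _ => rfl, fun d hd => absurd rfl hd⟩
  smul_mem' := by
    rintro a f ⟨hf, hf'⟩
    refine ⟨fun d => by simp [hf], fun d hd => ?_⟩
    apply hf'
    intro h
    exact hd (by simp [h])

lemma mem_T {σ : Perm D} {c : D → A} {f : D → ℚ} :
    f ∈ T σ c ↔ (∀ d, f (σ d) = f d) ∧ ∀ d, f d ≠ 0 → Triv σ c d := Iff.rfl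

lemma inv_sameCycle {X : Type} {σ : Perm D} {f : D → X} (hf : ∀ d, f (σ d) = f d) {d e : D}
    (h : σ.SameCycle d e) : f e = f d := by
  obtain ⟨i, rfl⟩ := h
  induction i using Int.induction_on with
  | zero => simp
  | succ n ih => rw [add_comm, zpow_add, zpow_one, Perm.mul_apply, hf, ih]
  | pred n ih =>
    rw [← hf, ← Perm.mul_apply, ← zpow_one_add]
    simpa using ih

lemma mem_T_iff {σ : Perm D} {c : D → A} {f : D → ℚ} :
    f ∈ T σ c ↔ (∀ d, f (σ d) = f d) ∧ ∃ g : D → A, ∀ d, f d ≠ 0 → g (σ d) = g d * c d := by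
  classical
  rw [mem_T]
  refine and_congr_right fun hf => ⟨fun h => ?_, ?_⟩
  · let r : D → D := fun d => (Quotient.mk (SameCycle.setoid σ) d).out
    have hr : ∀ d, σ.SameCycle (r d) d := fun d => by
      have := Quotient.mk_out (s := SameCycle.setoid σ) d
      exact this
    have hr2 : ∀ d, r (σ d) = r d := fun d => by
      have : (Quotient.mk (SameCycle.setoid σ) (σ d)) = Quotient.mk (SameCycle.setoid σ) d := by
        apply Quotient.sound
        exact (sameCycle_apply_left.2 (SameCycle.refl σ d) : SameCycle σ (σ d) d)
      simp only [r, this]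
    have hex : ∀ d, ∃ g : D → A, Triv σ c d → ∀ e, σ.SameCycle d e → g (σ e) = g e * c e := by
      intro d
      by_cases h : Triv σ c d
      · obtain ⟨g, hg⟩ := h
        exact ⟨g, fun _ => hg⟩
      · exact ⟨1, fun h' => absurd h' h⟩
    choose G hG using hex
    refine ⟨fun d => G (r d) d, fun d hd => ?_⟩
    simp only [hr2]
    apply hG _ _ _ (hr d)
    apply h
    rw [← inv_sameCycle hf (hr d)]
    exact hd
  · rintro ⟨g, hg⟩ d hd
    refine ⟨g, fun e he => hg e ?_⟩
    rwa [inv_sameCycle hf he]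

section core
variable [DecidableEq D]

lemma swap_ap {u v d : D} {σ : Perm D} (h1 : σ d ≠ u) (h2 : σ d ≠ v) :
    (swap u v * σ) d = σ d := by
  rw [Perm.mul_apply, swap_apply_of_ne_of_ne h1 h2]

lemma inv_swap {X : Type} {σ : Perm D} {u v : D} {f : D → X} (hf : ∀ d, f (σ d) = f d) (huv : f u = f v)
    (d : D) : f ((swap u v * σ) d) = f d := by
  rw [Perm.mul_apply, ← hf d]
  rcases swap_apply_eq_iff.1 (rfl : swap u v (σ d) = _) with _
  by_cases h1 : σ d = u
  · rw [h1, swap_apply_left, huv]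
  by_cases h2 : σ d = v
  · rw [h2, swap_apply_right, huv]
  rw [swap_apply_of_ne_of_ne h1 h2]

lemma T_swap_zero {σ : Perm D} {c : D → A} {u v : D} {f : D → ℚ} (hf : f ∈ T σ c)
    (hu : f u = 0) (hv : f v = 0) : f ∈ T (swap u v * σ) c := by
  rw [mem_T_iff] at hf ⊢
  obtain ⟨hf, g, hg⟩ := hf
  refine ⟨inv_swap hf (hu.trans hv.symm), g, fun d hd => ?_⟩
  rw [swap_ap, hg d hd]
  · rintro h; rw [← hf, h] at hd; exact hd hu
  · rintro h; rw [← hf, h] at hd; exact hd hv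

/-- merging two cycles -/
lemma T_swap_merge {σ : Perm D} {c : D → A} {u v : D} (huv : ¬ σ.SameCycle u v) {f : D → ℚ}
    (hf : f ∈ T σ c) (h : f u = f v) : f ∈ T (swap u v * σ) c := by
  classical
  rw [mem_T_iff] at hf ⊢
  obtain ⟨hf, g, hg⟩ := hf
  refine ⟨inv_swap hf h, fun d => if σ.SameCycle v d then g u * (g v)⁻¹ * g d else g d,
    fun d hd => ?_⟩
  have key : ∀ d, f d ≠ 0 → (if σ.SameCycle v (σ d) then g u * (g v)⁻¹ * g (σ d) else g (σ d))
    = (if σ.SameCycle v d then g u * (g v)⁻¹ * g d else g d) * c d := by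
    intro d hd
    rw [sameCycle_apply_right, hg d hd]
    split_ifs <;> group
  simp only
  rw [← key d hd, Perm.mul_apply]
  have hvu : ¬ σ.SameCycle v u := fun h => huv h.symm
  by_cases h1 : σ d = u
  · simp [h1, hvu, SameCycle.refl]
  by_cases h2 : σ d = v
  · simp [h2, hvu, SameCycle.refl]
  rw [swap_apply_of_ne_of_ne h1 h2]

variable [Finite D]

lemma walk {X : Type} {σ : Perm D} {u v : D} (huv : ¬ σ.SameCycle u v) {P : D → Prop}
    (h0 : P u) (hs : ∀ d, P d → σ d ≠ u → σ d ≠ v → P (σ d)) : P (σ⁻¹ u) := by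
  have : ∀ i : ℕ, P ((σ ^ i) u) := by
    intro i
    induction i with
    | zero => simpa
    | succ n ih =>
      rw [pow_succ', Perm.mul_apply]
      by_cases h1 : σ ((σ ^ n) u) = u
      · rwa [h1]
      · apply hs _ ih h1
        intro h2
        exact huv ⟨(n+1 : ℕ), by rw [zpow_natCast, pow_succ', Perm.mul_apply, h2]⟩
  have h : σ.SameCycle u (σ⁻¹ u) := by simp [SameCycle.refl]
  obtain ⟨i, hi⟩ := h.exists_nat_pow_eq
  rw [← hi]
  exact this i

lemma inv_merge {X : Type} {σ : Perm D} {u v : D} (huv : ¬ σ.SameCycle u v) {f : D → X}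
    (hf : ∀ d, f ((swap u v * σ) d) = f d) : f u = f v := by
  have := walk (X := X) (P := fun d => f d = f u) huv rfl (fun d hd h1 h2 => by
    rw [← swap_ap h1 h2, hf, hd])
  rw [← this, ← hf]
  simp

lemma split_aux {σ : Perm D} {c : D → A} {u v : D} (huv : ¬ σ.SameCycle u v) (ht : Triv σ c u)
    {g : D → A} {f : D → ℚ} (hf : ∀ d, f ((swap u v * σ) d) = f d)
    (hg : ∀ d, f d ≠ 0 → g ((swap u v * σ) d) = g d * c d) (hu : f u ≠ 0) : g u = g v := by
  obtain ⟨h, hh⟩ := ht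
  have := walk (X := ℕ) (P := fun d => f d ≠ 0 ∧ σ.SameCycle u d ∧ g u * (h u)⁻¹ * h d = g d) huv
    ⟨hu, SameCycle.refl _ _, by group⟩ (by
    rintro d ⟨hd, hs, he⟩ h1 h2
    refine ⟨?_, by rwa [sameCycle_apply_right], ?_⟩
    · rw [← swap_ap h1 h2, hf]; exact hd
    · rw [hh d hs, ← mul_assoc, he, ← swap_ap h1 h2, hg d hd])
  obtain ⟨h1, h2, h3⟩ := this
  have e1 := hg _ h1
  have e2 := hh _ h2
  have e0 : σ (σ⁻¹ u) = u := σ.apply_symm_apply u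
  rw [Perm.mul_apply, e0, swap_apply_left] at e1
  rw [e0] at e2
  rw [e1, ← h3, mul_assoc, ← e2]
  group

lemma T_swap_split {σ : Perm D} {c : D → A} {u v : D} (huv : ¬ σ.SameCycle u v)
    (ht : Triv σ c u ∨ Triv σ c v) {f : D → ℚ} (hf : f ∈ T (swap u v * σ) c) : f ∈ T σ c := by
  rw [mem_T_iff] at hf
  obtain ⟨hf, g, hg⟩ := hf
  have e := inv_merge huv hf
  have es : swap u v * (swap u v * σ) = σ := by rw [← mul_assoc]; simp
  by_cases hu : f u = 0
  · have := T_swap_zero (mem_T_iff.2 ⟨hf, g, hg⟩) hu (e ▸ hu)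
    rwa [es] at this
  have e2 : g u = g v := by
    rcases ht with ht | ht
    · exact split_aux huv ht hf hg hu
    · rw [swap_comm] at hf hg
      exact (split_aux (fun h => huv h.symm) ht hf hg (e ▸ hu)).symm
  rw [mem_T_iff]
  refine ⟨fun d => ?_, g, fun d hd => ?_⟩
  · have := inv_swap hf e d
    rwa [es] at this
  · rw [← hg d hd]
    conv_lhs => rw [← es]
    rw [Perm.mul_apply]
    generalize (swap u v * σ) d = x
    by_cases h1 : x = u
    · simp [h1, e2]
    by_cases h2 : x = v
    · simp [h2, e2]
    rw [swap_apply_of_ne_of_ne h1 h2]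

/-- same cycle before the swap, different after it -/
lemma swap_dichotomy {σ : Perm D} {u v : D} (huv : u ≠ v) (h : σ.SameCycle u v) :
    ¬ (swap u v * σ).SameCycle u v := by
  classical
  obtain ⟨i, hi⟩ := h.exists_nat_pow_eq
  have hex : ∃ i, (σ ^ i) u = v := ⟨i, hi⟩
  set k := Nat.find hex with hk
  have hkv : (σ ^ k) u = v := Nat.find_spec hex
  have hmin : ∀ j < k, (σ ^ j) u ≠ v := fun j hj => Nat.find_min hex hj
  have hminu : ∀ j < k, 0 < j → (σ ^ j) u ≠ u := by
    intro j hj hj0 he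
    apply hmin (k - j) (by omega)
    rw [← hkv]
    conv_rhs => rw [show k = (k - j) + j by omega, pow_add, Perm.mul_apply, he]
  have hk0 : k ≠ 0 := by
    intro h0
    rw [h0] at hkv
    exact huv (by simpa using hkv)
  have hpow : ∀ n : ℕ, ∃ j < k, ((swap u v * σ) ^ n) u = (σ ^ j) u := by
    intro n
    induction n with
    | zero => exact ⟨0, by omega, by simp⟩
    | succ n ih =>
      obtain ⟨j, hj, e⟩ := ih
      rw [pow_succ', Perm.mul_apply, e]
      rcases Nat.lt_or_ge (j + 1) k with h | h
      · refine ⟨j + 1, h, ?_⟩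
        have e3 : σ ((σ ^ j) u) = (σ ^ (j+1)) u := by rw [pow_succ', Perm.mul_apply]
        rw [swap_ap, e3]
        · rw [e3]; exact hminu _ h (by omega)
        · rw [e3]; exact hmin _ h
      · refine ⟨0, by omega, ?_⟩
        have : j + 1 = k := by omega
        rw [Perm.mul_apply, ← Perm.mul_apply σ, ← pow_succ', this, hkv]
        simp
  intro h'
  obtain ⟨n, hn⟩ := h'.exists_nat_pow_eq
  obtain ⟨j, hj, e⟩ := hpow n
  exact hmin j hj (e ▸ hn)

/-- evaluation difference -/
def dl (u v : D) : (D → ℚ) →ₗ[ℚ] ℚ := (LinearMap.proj u : (D → ℚ) →ₗ[ℚ] ℚ) - LinearMap.proj v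

@[simp] lemma dl_apply (u v : D) (f : D → ℚ) : dl u v f = f u - f v := rfl

lemma mem_ker_dl {u v : D} {f : D → ℚ} : f ∈ LinearMap.ker (dl u v) ↔ f u = f v := by
  rw [LinearMap.mem_ker, dl_apply, sub_eq_zero]

lemma T_core_a {σ : Perm D} {c : D → A} {u v : D} (h : ∃ f ∈ T σ c, f u ≠ f v) :
    T (swap u v * σ) c = T σ c ⊓ LinearMap.ker (dl u v) := by
  obtain ⟨f, hf, hne⟩ := h
  have huv : ¬ σ.SameCycle u v := fun h => hne (inv_sameCycle hf.1 h).symm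
  have ht : Triv σ c u ∨ Triv σ c v := by
    by_cases h : f u = 0
    · right; apply hf.2; rw [← h]; exact hne.symm
    · left; exact hf.2 _ h
  ext f
  rw [Submodule.mem_inf, mem_ker_dl]
  exact ⟨fun h => ⟨T_swap_split huv ht h, inv_merge huv h.1⟩, fun h => T_swap_merge huv h.1 h.2⟩

lemma T_trans_aux {σ : Perm D} {c : D → A} {u v : D} (huv : ¬ σ.SameCycle u v) :
    ∃ l : (D → ℚ) →ₗ[ℚ] ℚ, T (swap u v * σ) c = T σ c ⊓ LinearMap.ker l ∨
      T σ c = T (swap u v * σ) c ⊓ LinearMap.ker l := by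
  by_cases h : ∃ f ∈ T σ c, f u ≠ f v
  · exact ⟨_, Or.inl (T_core_a h)⟩
  push Not at h
  refine ⟨LinearMap.proj u, Or.inr ?_⟩
  have hz : ∀ f ∈ T σ c, f u = 0 := by
    classical
    intro f hf
    have : (fun d => if σ.SameCycle u d then f d else 0) ∈ T σ c := by
      refine ⟨fun d => by simp [sameCycle_apply_right, hf.1], fun d hd => ?_⟩
      apply hf.2
      intro h; simp [h] at hd
    have := h _ this
    simpa [huv, SameCycle.refl] using this
  ext f
  rw [Submodule.mem_inf, LinearMap.mem_ker, LinearMap.proj_apply]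
  constructor
  · intro hf
    exact ⟨T_swap_merge huv hf (h f hf), hz f hf⟩
  · rintro ⟨hf, h0⟩
    have := T_swap_zero hf h0 (inv_merge huv hf.1 ▸ h0)
    rwa [← mul_assoc, swap_mul_self, one_mul] at this

lemma T_trans (σ : Perm D) (c : D → A) (u v : D) :
    ∃ l : (D → ℚ) →ₗ[ℚ] ℚ, T (swap u v * σ) c = T σ c ⊓ LinearMap.ker l ∨
      T σ c = T (swap u v * σ) c ⊓ LinearMap.ker l := by
  by_cases e : u = v
  · subst e
    exact ⟨0, Or.inl (by rw [swap_self]; change T (1 * σ) c = _; simp)⟩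
  by_cases huv : σ.SameCycle u v
  · obtain ⟨l, h⟩ := T_trans_aux (c := c) (swap_dichotomy e huv)
    rw [← mul_assoc, swap_mul_self, one_mul] at h
    exact ⟨l, h.symm⟩
  · exact T_trans_aux huv

lemma single_mem_T {σ : Perm D} {c : D → A} {x : D} (hx : σ x = x) (hc : c x = 1) :
    (Pi.single x 1 : D → ℚ) ∈ T σ c := by
  rw [mem_T_iff]
  constructor
  · intro d
    by_cases h : d = x
    · rw [h, hx]
    · have : σ d ≠ x := fun h' => h (σ.injective (h'.trans hx.symm))
      simp [Pi.single_apply, h, this]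
  · refine ⟨1, fun d hd => ?_⟩
    have : d = x := by
      by_contra h; simp [Pi.single_apply, h] at hd
    simp [this, hc]

lemma T_rem {σ : Perm D} {c : D → A} {x : D} (hc : c x = 1) (hx : σ x ≠ x) :
    (swap x (σ x) * σ) x = x ∧ (Pi.single x 1 : D → ℚ) ∈ T (swap x (σ x) * σ) c ∧
    T σ c = T (swap x (σ x) * σ) c ⊓ LinearMap.ker (dl x (σ x)) := by
  have h1 : (swap x (σ x) * σ) x = x := by simp
  have h2 := single_mem_T h1 hc
  refine ⟨h1, h2, ?_⟩
  rw [← T_core_a ⟨_, h2, by simp [Pi.single_apply, hx]⟩, ← mul_assoc, swap_mul_self, one_mul]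

end core

section dist
variable [Fintype D]

open Module

/-- distance of subspaces -/
noncomputable def dist (U W : Submodule ℚ (D → ℚ)) : ℤ :=
  (finrank ℚ U : ℤ) + finrank ℚ W - 2 * finrank ℚ (U ⊓ W : Submodule ℚ (D → ℚ))

lemma fr_exact {W : Submodule ℚ (D → ℚ)} {l : (D → ℚ) →ₗ[ℚ] ℚ} (h : ∃ f ∈ W, l f ≠ 0) :
    finrank ℚ (W ⊓ LinearMap.ker l : Submodule ℚ (D → ℚ)) + 1 = finrank ℚ W := by
  obtain ⟨f, hf, hl⟩ := h
  have h1 := LinearMap.finrank_range_add_finrank_ker (l.domRestrict W)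
  have h2 : LinearMap.range (l.domRestrict W) = ⊤ := by
    rw [LinearMap.range_eq_top]
    intro q
    refine ⟨(q / l f) • ⟨f, hf⟩, ?_⟩
    rw [map_smul, LinearMap.domRestrict_apply, smul_eq_mul]
    field_simp
  rw [h2, finrank_top, finrank_self] at h1
  have h3 : finrank ℚ (W ⊓ LinearMap.ker l : Submodule ℚ (D → ℚ)) =
      finrank ℚ (LinearMap.ker (l.domRestrict W)) := by
    have : LinearMap.ker (l.domRestrict W) = (LinearMap.ker l).comap W.subtype := by
      ext x; simp
    rw [this, inf_comm]
    have e : (LinearMap.ker l ⊓ W : Submodule ℚ (D → ℚ)) = ((LinearMap.ker l).comap W.subtype).map W.subtype := by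
      rw [Submodule.map_comap_subtype, inf_comm]
    rw [e]
    exact (LinearEquiv.finrank_eq (Submodule.equivMapOfInjective _ W.subtype_injective _)).symm
  omega

lemma fr_triv {W : Submodule ℚ (D → ℚ)} {l : (D → ℚ) →ₗ[ℚ] ℚ} (h : ¬ ∃ f ∈ W, l f ≠ 0) :
    W ⊓ LinearMap.ker l = W := by
  push Not at h
  exact inf_eq_left.2 fun f hf => h f hf

lemma dist_lip (I W : Submodule ℚ (D → ℚ)) (l : (D → ℚ) →ₗ[ℚ] ℚ) :
    dist I (W ⊓ LinearMap.ker l) ≤ dist I W + 1 ∧ dist I W ≤ dist I (W ⊓ LinearMap.ker l) + 1 := by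
  unfold dist
  rw [← inf_assoc]
  by_cases h : ∃ f ∈ W, l f ≠ 0
  · have h1 := fr_exact h
    by_cases h' : ∃ f ∈ I ⊓ W, l f ≠ 0
    · have h2 := fr_exact h'
      omega
    · rw [fr_triv h']
      omega
  · have h' : ¬ ∃ f ∈ I ⊓ W, l f ≠ 0 := fun ⟨f, hf, hl⟩ => h ⟨f, hf.2, hl⟩
    rw [fr_triv h', fr_triv h]
    omega

lemma dist_drop {U W : Submodule ℚ (D → ℚ)} {l : (D → ℚ) →ₗ[ℚ] ℚ} {e : D → ℚ} (hU : e ∈ U)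
    (hW : e ∈ W) (he : l e ≠ 0) :
    dist (U ⊓ LinearMap.ker l) (W ⊓ LinearMap.ker l) = dist U W := by
  unfold dist
  have h1 := fr_exact ⟨e, hU, he⟩
  have h2 := fr_exact ⟨e, hW, he⟩
  have h3 := fr_exact (W := U ⊓ W) ⟨e, ⟨hU, hW⟩, he⟩
  rw [← inf_inf_distrib_right]
  omega

lemma dist_pinch {U W : Submodule ℚ (D → ℚ)} {l : (D → ℚ) →ₗ[ℚ] ℚ} :
    dist (U ⊓ LinearMap.ker l) (W ⊓ LinearMap.ker l) ≤ dist U W ∨ ¬ (∃ f ∈ U, l f ≠ 0) ∨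
      ¬ (∃ f ∈ W, l f ≠ 0) := by
  by_cases h : ∃ f ∈ U, l f ≠ 0
  · by_cases h' : ∃ f ∈ W, l f ≠ 0
    · left
      unfold dist
      have h1 := fr_exact h
      have h2 := fr_exact h'
      rw [← inf_inf_distrib_right]
      by_cases h'' : ∃ f ∈ U ⊓ W, l f ≠ 0
      · have h3 := fr_exact h''
        omega
      · rw [fr_triv h'']
        omega
    · exact Or.inr (Or.inr h')
  · exact Or.inr (Or.inl h)

lemma dist_T_trans [DecidableEq D] (I : Submodule ℚ (D → ℚ)) (σ : Perm D) (c : D → A) (u v : D) :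
    dist I (T (swap u v * σ) c) ≤ dist I (T σ c) + 1 ∧
    dist I (T σ c) ≤ dist I (T (swap u v * σ) c) + 1 := by
  obtain ⟨l, h | h⟩ := T_trans σ c u v
  · rw [h]; exact dist_lip _ _ _
  · rw [h]; exact (dist_lip _ _ _).symm

end dist
end Pf

namespace Pf
open Equiv Equiv.Perm
variable {D A : Type} [Group A] [Fintype D] [DecidableEq D]

/-- a valid pairing of darts -/
def Valid (ε : D → ℤ) (α : Perm D) : Prop :=
  (∀ d, α (α d) = d) ∧ (∀ d, ε (α d) = - ε d) ∧ ∀ d, ε d = 0 → α d = d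

/-- number of non-marker darts -/
def Mc (ε : D → ℤ) : ℕ := (Finset.univ.filter (fun d => ε d ≠ 0)).card

/-- the face space -/
abbrev FI (A : Type) [Group A] (φ : Perm D) : Submodule ℚ (D → ℚ) := T φ (fun _ => (1 : A))

lemma mem_FI {φ : Perm D} {f : D → ℚ} : f ∈ FI A φ ↔ ∀ d, f (φ d) = f d := by
  rw [mem_T_iff]
  refine and_iff_left ⟨1, fun d _ => by simp⟩

/-- too many faces and vertices -/
def Bad (φ : Perm D) (ε : D → ℤ) (c : D → A) : Prop :=
  ∃ α : Perm D, Valid ε α ∧ (Mc ε : ℤ) < 2 * dist (FI A φ) (T (α * φ) c)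

lemma T_gauge {σ : Perm D} {c : D → A} {q y : D} (hq : σ q = y) (hne : q ≠ y) :
    T σ (Function.update (Function.update c q (c q * c y)) y 1) = T σ c := by
  have hy : σ y ≠ y := fun h => hne (σ.injective (hq.trans h.symm))
  have hne' := hne.symm
  ext f
  rw [mem_T_iff, mem_T_iff]
  refine and_congr_right fun hf => ⟨?_, ?_⟩
  · rintro ⟨g, hg⟩
    refine ⟨Function.update g y (g y * (c y)⁻¹), fun d hd => ?_⟩
    have := hg d hd
    by_cases h1 : d = y
    · subst h1
      simp only [Function.update_apply, hy, if_true, if_false] at this ⊢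
      rw [this]; group
    by_cases h2 : d = q
    · subst h2
      rw [hq] at this ⊢
      simp only [Function.update_apply, hne, if_true, if_false] at this ⊢
      rw [this]; group
    have h3 : σ d ≠ y := fun h => h2 (σ.injective (h.trans hq.symm))
    simpa only [Function.update_apply, h1, h2, h3, if_false] using this
  · rintro ⟨g, hg⟩
    refine ⟨Function.update g y (g y * (c y)), fun d hd => ?_⟩
    have := hg d hd
    by_cases h1 : d = y
    · subst h1
      simp only [Function.update_apply, hy, if_true, if_false] at this ⊢
      rw [this]; group
    by_cases h2 : d = q
    · subst h2
      rw [hq] at this ⊢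
      simp only [Function.update_apply, hne, if_true, if_false] at this ⊢
      rw [this]; group
    have h3 : σ d ≠ y := fun h => h2 (σ.injective (h.trans hq.symm))
    simpa only [Function.update_apply, h1, h2, h3, if_false] using this

lemma mul_swap_perm (α : Perm D) (u v : D) (φ : Perm D) :
    α * (swap u v * φ) = swap (α u) (α v) * (α * φ) := by
  rw [Equiv.swap_apply_apply]
  group

/-- removing a fixed unlabelled dart -/
lemma T_rem' {σ : Perm D} {c : D → A} {q y : D} (hc : c y = 1) (hq : σ q = y) (hne : q ≠ y) :
    (Pi.single y 1 : D → ℚ) ∈ T (swap y (σ y) * σ) c ∧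
    T σ c = T (swap y (σ y) * σ) c ⊓ LinearMap.ker (dl y q) := by
  have hy : σ y ≠ y := fun h => hne (σ.injective (hq.trans h.symm))
  obtain ⟨h1, h2, h3⟩ := T_rem hc hy
  refine ⟨h2, ?_⟩
  rw [h3]
  ext f
  simp only [Submodule.mem_inf, mem_ker_dl]
  refine and_congr_right fun hf => ?_
  have := hf.1 q
  rw [Perm.mul_apply, hq, swap_apply_left] at this
  rw [this]

lemma absorb_aux {φ : Perm D} {ε : D → ℤ} {c : D → A} {q y : D} (hq : φ q = y) (hne : q ≠ y)
    (hε : ε y = 0) {α : Perm D} (hα : Valid ε α) :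
    dist (FI A (swap y (φ y) * φ)) (T (α * (swap y (φ y) * φ))
      (Function.update (Function.update c q (c q * c y)) y 1)) =
    dist (FI A φ) (T (α * φ) c) := by
  have hy := hα.2.2 y hε
  have hσ : (α * φ) q = y := by rw [Perm.mul_apply, hq, hy]
  rw [mul_swap_perm, hy, ← Perm.mul_apply α φ, ← T_gauge (c := c) hσ hne]
  obtain ⟨h1, h2⟩ := T_rem' (c := Function.update (Function.update c q (c q * c y)) y 1)
    (by simp) hσ hne
  obtain ⟨h3, h4⟩ := T_rem' (c := fun _ => (1 : A)) rfl hq hne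
  rw [h2, show FI A φ = _ from h4]
  exact (dist_drop h3 h1 (by simp [hne])).symm

lemma bad_absorb {φ : Perm D} {ε : D → ℤ} {c : D → A} {q y : D} (hq : φ q = y) (hne : q ≠ y)
    (hε : ε y = 0) :
    Bad φ ε c ↔ Bad (swap y (φ y) * φ) ε
      (Function.update (Function.update c q (c q * c y)) y 1) := by
  refine exists_congr fun α => and_congr_right fun hα => ?_
  rw [absorb_aux hq hne hε hα]

lemma Mc_zero {ε : D → ℤ} {x y : D} (hxy : x ≠ y) (hx : ε x ≠ 0) (hy : ε y ≠ 0) :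
    Mc (Function.update (Function.update ε x 0) y 0) + 2 = Mc ε := by
  unfold Mc
  have : (Finset.univ.filter (fun d => ε d ≠ 0)) = insert x (insert y
    (Finset.univ.filter (fun d => Function.update (Function.update ε x 0) y 0 d ≠ 0))) := by
    ext d
    simp only [Finset.mem_filter, Finset.mem_univ, true_and, Finset.mem_insert,
      Function.update_apply]
    by_cases h1 : d = x
    · simp [h1, hx]
    by_cases h2 : d = y
    · simp [h2, hy]
    simp [h1, h2]
  rw [this, Finset.card_insert_of_notMem, Finset.card_insert_of_notMem]
  · simp
  · simp [hxy, Function.update_apply]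

/-- paired adjacent darts -/
lemma zero_aux {φ : Perm D} {c : D → A} {x y : D} (hxy : x ≠ y) (hφ : φ x = y) (hc : c x = 1)
    {β : Perm D} (hx : β x = x) (hy : β y = y) :
    dist (FI A φ) (T (β * swap x y * φ) c) = dist (FI A φ) (T (β * φ) c) + 1 := by
  have h1 : β * swap x y * φ = swap x y * (β * φ) := by
    rw [mul_assoc, mul_swap_perm, hx, hy]
  have h2 : (β * φ) x = y := by rw [Perm.mul_apply, hφ, hy]
  obtain ⟨h3, h4, h5⟩ := T_rem (σ := β * φ) hc (by rw [h2]; exact hxy.symm)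
  rw [h2, ← h1] at h3 h4 h5
  have h6 := fr_exact (W := T (β * swap x y * φ) c) (l := dl x y) ⟨_, h4, by simp [hxy.symm, hxy]⟩
  have h7 : FI A φ ⊓ T (β * φ) c = FI A φ ⊓ T (β * swap x y * φ) c := by
    rw [h5]
    ext f
    simp only [Submodule.mem_inf, mem_ker_dl, mem_FI]
    refine and_congr_right fun hf => and_iff_left ?_
    rw [← hφ, hf]
  unfold dist
  rw [h7, h5]
  omega

lemma valid_unzero {ε : D → ℤ} {x y : D} (hxy : x ≠ y) (hx : ε x = - ε y)
    {β : Perm D} (hβ : Valid (Function.update (Function.update ε x 0) y 0) β) :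
    β x = x ∧ β y = y ∧ (ε y ≠ 0 → Valid ε (β * swap x y)) := by
  obtain ⟨h1, h2, h3⟩ := hβ
  have bx : β x = x := h3 x (by simp [Function.update_apply, hxy])
  have by' : β y = y := h3 y (by simp [Function.update_apply])
  refine ⟨bx, by', fun hy => ?_⟩
  have key : ∀ d, d ≠ x → d ≠ y → (β d ≠ x ∧ β d ≠ y) := fun d hdx hdy =>
    ⟨fun h => hdx (β.injective (h.trans bx.symm)), fun h => hdy (β.injective (h.trans by'.symm))⟩
  refine ⟨fun d => ?_, fun d => ?_, fun d hd => ?_⟩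
  · simp only [Perm.mul_apply]
    by_cases hdx : d = x
    · subst hdx; simp [by', bx]
    by_cases hdy : d = y
    · subst hdy; simp [by', bx]
    rw [swap_apply_of_ne_of_ne hdx hdy, swap_apply_of_ne_of_ne (key d hdx hdy).1 (key d hdx hdy).2, h1]
  · simp only [Perm.mul_apply]
    by_cases hdx : d = x
    · subst hdx; simp [by', bx, hx]
    by_cases hdy : d = y
    · subst hdy; simp [by', bx, hx]
    rw [swap_apply_of_ne_of_ne hdx hdy]
    have := h2 d
    simpa [Function.update_apply, hdx, hdy, key d hdx hdy] using this
  · have hdx : d ≠ x := by rintro rfl; omega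
    have hdy : d ≠ y := by rintro rfl; omega
    simp only [Perm.mul_apply]
    rw [swap_apply_of_ne_of_ne hdx hdy]
    apply h3
    simp [Function.update_apply, hdx, hdy, hd]

lemma valid_zero {ε : D → ℤ} {α : Perm D} (hα : Valid ε α) {x : D} (hx : ε x ≠ 0) :
    Valid (Function.update (Function.update ε x 0) (α x) 0) (α * swap x (α x)) := by
  obtain ⟨h1, h2, h3⟩ := hα
  have hne : α x ≠ x := fun h => by have := h2 x; rw [h] at this; omega
  refine ⟨fun d => ?_, fun d => ?_, fun d hd => ?_⟩
  all_goals
    simp only [Perm.mul_apply, swap_apply_def, Function.update_apply] at *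
    have := α.injective
    have h1d := h1 d
    have h1x := h1 x
    have h2d := h2 d
    have h3d := h3 d
    grind

lemma zero_hard {φ : Perm D} {ε : D → ℤ} {c : D → A} {x y : D} (hφ : φ x = y)
    (hc : c x = 1) (hxy : ε x = - ε y) (hy : ε y ≠ 0) {α : Perm D} (hα : Valid ε α)
    (hne : α x ≠ y) : ∃ β, Valid (Function.update (Function.update ε x 0) y 0) β ∧
      dist (FI A φ) (T (α * φ) c) ≤ dist (FI A φ) (T (β * φ) c) + 1 := by
  obtain ⟨h1, h2, h3⟩ := hα
  have exy : x ≠ y := by rintro rfl; omega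
  obtain ⟨x', hx'⟩ : ∃ x', α x = x' := ⟨_, rfl⟩
  obtain ⟨y', hy'⟩ : ∃ y', α y = y' := ⟨_, rfl⟩
  have ax' : α x' = x := by rw [← hx', h1]
  have ay' : α y' = y := by rw [← hy', h1]
  have e1 : x' ≠ x := by rintro rfl; have := h2 x'; rw [hx'] at this; omega
  have e2 : y' ≠ y := by rintro rfl; have := h2 y'; rw [hy'] at this; omega
  have e3 : x' ≠ y := hx' ▸ hne
  have e4 : y' ≠ x := by rintro rfl; exact hne ay'
  have e5 : x' ≠ y' := by rintro rfl; exact exy (ax'.symm.trans ay')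
  let b : D → D := fun d => if d = x then x else if d = y then y else if d = x' then y' else
    if d = y' then x' else α d
  have hb : Function.Involutive b := by
    intro d
    have := h1 d
    simp only [b]
    have i := α.injective
    grind
  let β : Perm D := hb.toPerm
  have hβ : ∀ d, β d = if d = x then x else if d = y then y else if d = x' then y' else
    if d = y' then x' else α d := fun d => rfl
  let α1 : Perm D := swap x x' * β
  have hα1 : ∀ d, α1 d = if d = x then x' else if d = y then y else if d = x' then y' else
    if d = y' then x else α d := by
    intro d
    simp only [α1, Perm.mul_apply, hβ, swap_apply_def]
    have i := α.injective
    have := h1 d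
    grind
  refine ⟨β, ⟨hb, fun d => ?_, fun d hd => ?_⟩, ?_⟩
  · simp only [hβ, Function.update_apply]
    have := h2 d
    have h2x := h2 x
    have h2y := h2 y
    have i := α.injective
    have := h1 d
    grind
  · simp only [hβ, Function.update_apply] at hd ⊢
    have := h3 d
    have := h3 x'
    have := h3 y'
    have := h2 x
    have := h2 y
    grind
  have s1 : (α1 * φ) x = y := by
    rw [Perm.mul_apply, hφ, hα1]; simp [exy.symm]
  have s0 : (α * φ) x = y' := by
    rw [Perm.mul_apply, hφ, hy']
  obtain ⟨a1, a2, a3⟩ := T_rem (σ := α * φ) hc (by rw [s0]; exact e4)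
  obtain ⟨b1, b2, b3⟩ := T_rem (σ := α1 * φ) hc (by rw [s1]; exact exy.symm)
  rw [s0] at a1 a2 a3
  rw [s1] at b1 b2 b3
  have hr : swap x y' * (α * φ) = swap x y * (α1 * φ) := by
    rw [← mul_assoc, ← mul_assoc]
    congr 1
    ext d
    simp only [Perm.mul_apply, hα1, swap_apply_def]
    have i := α.injective
    have := h1 d
    grind
  rw [← hr] at b1 b2 b3
  have a4 := fr_exact (l := dl x y') ⟨_, a2, by simp [e4, e4.symm]⟩
  have b4 := fr_exact (l := dl x y) ⟨_, b2, by simp [exy, exy.symm]⟩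
  rw [← a3] at a4
  rw [← b3] at b4
  have hI : FI A φ ⊓ T (α * φ) c = FI A φ ⊓ T (α1 * φ) c := by
    ext f
    simp only [Submodule.mem_inf]
    refine and_congr_right fun hf => ?_
    rw [mem_FI] at hf
    constructor
    · intro h
      rw [a3] at h
      rw [b3]
      exact ⟨h.1, mem_ker_dl.2 (by rw [← hφ, hf])⟩
    · intro h
      have hinv := h.1
      rw [b3] at h
      rw [a3]
      refine ⟨h.1, mem_ker_dl.2 ?_⟩
      have k1 := hinv (φ.symm x)
      have k2 := hf (φ.symm x)
      have k3 := hinv (φ.symm x')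
      have k4 := hf (φ.symm x')
      simp only [Perm.mul_apply, apply_symm_apply, hα1, if_true, e1, e3, if_false] at k1 k2 k3 k4
      rw [k2, ← k1, k4, ← k3]
  have hd : dist (FI A φ) (T (α * φ) c) = dist (FI A φ) (T (α1 * φ) c) := by
    unfold dist
    rw [hI]
    omega
  rw [hd]
  have : β * φ = swap x x' * (α1 * φ) := by
    simp only [α1]
    rw [← mul_assoc, ← mul_assoc, swap_mul_self, one_mul]
  rw [this]
  exact (dist_T_trans _ _ _ _ _).2

lemma bad_zero {φ : Perm D} {ε : D → ℤ} {c : D → A} {x y : D} (hφ : φ x = y)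
    (hc : c x = 1) (hxy : ε x = - ε y) (hy : ε y ≠ 0) :
    Bad φ ε c ↔ Bad φ (Function.update (Function.update ε x 0) y 0) c := by
  have exy : x ≠ y := by rintro rfl; omega
  have hM := Mc_zero exy (by omega) hy
  constructor
  · rintro ⟨α, hα, hlt⟩
    by_cases hne : α x = y
    · subst hne
      have hv := valid_zero hα (x := x) (by omega)
      have hu := valid_unzero exy hxy hv
      refine ⟨_, hv, ?_⟩
      have := zero_aux exy hφ hc hu.1 hu.2.1
      rw [mul_assoc α, swap_mul_self, mul_one] at this
      omega
    · obtain ⟨β, hβ, hd⟩ := zero_hard hφ hc hxy hy hα hne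
      exact ⟨β, hβ, by omega⟩
  · rintro ⟨β, hβ, hlt⟩
    obtain ⟨h1, h2, h3⟩ := valid_unzero exy hxy hβ
    refine ⟨_, h3 hy, ?_⟩
    rw [zero_aux exy hφ hc h1 h2]
    omega

lemma exists_FI_ne {φ : Perm D} {u v : D} (h : ¬ φ.SameCycle u v) : ∃ f ∈ FI A φ, f u ≠ f v := by
  classical
  refine ⟨fun d => if φ.SameCycle u d then 1 else 0, mem_FI.2 fun d => ?_, ?_⟩
  · simp [sameCycle_apply_right]
  · simp [h, SameCycle.refl]

lemma bad_pinch {φ : Perm D} {ε : D → ℤ} {c : D → A} {u v : D} (huv : u ≠ v)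
    (hs : φ.SameCycle u v) (hb : Bad φ ε c) : Bad (φ * swap u v) ε c := by
  obtain ⟨α, hα, hlt⟩ := hb
  refine ⟨α, hα, lt_of_lt_of_le hlt ?_⟩
  have key : ∀ ψ : Perm D, ψ * swap u v = swap (ψ u) (ψ v) * ψ := by
    intro ψ
    have := mul_swap_perm ψ u v 1
    simpa using this
  have kin : ∀ (ψ : Perm D) (c : D → A) (f : D → ℚ), f ∈ T (ψ * swap u v) c → f (ψ u) = f v ∧ f (ψ v) = f u := by
    intro ψ c f hf
    have h1 := hf.1 u
    have h2 := hf.1 v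
    simp only [Perm.mul_apply, swap_apply_left, swap_apply_right] at h1 h2
    exact ⟨h2, h1⟩
  have kback : ∀ (ψ : Perm D) (c : D → A), (∃ f ∈ T (ψ * swap u v) c, f u ≠ f v) →
      T ψ c = T (ψ * swap u v) c ⊓ LinearMap.ker (dl u v) := by
    intro ψ c ⟨f, hf, hne⟩
    have : T ψ c = T (ψ * swap u v) c ⊓ LinearMap.ker (dl (ψ u) (ψ v)) := by
      rw [← T_core_a ⟨f, hf, by rw [(kin _ _ _ hf).1, (kin _ _ _ hf).2]; exact hne.symm⟩, key,
        ← mul_assoc, swap_mul_self, one_mul]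
    rw [this]
    ext f
    simp only [Submodule.mem_inf, mem_ker_dl]
    refine and_congr_right fun hf => ?_
    rw [(kin _ _ _ hf).1, (kin _ _ _ hf).2, eq_comm]
  rw [← mul_assoc]
  have hI : ∃ f ∈ FI A (φ * swap u v), f u ≠ f v := by
    have h1 : ¬ (φ * swap u v).SameCycle (φ u) (φ v) := by
      rw [key]
      apply swap_dichotomy (φ.injective.ne huv)
      simpa using hs
    obtain ⟨f, hf, hne⟩ := exists_FI_ne (A := A) h1
    refine ⟨f, hf, ?_⟩
    rw [(kin _ _ _ hf).1, (kin _ _ _ hf).2] at hne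
    exact hne.symm
  have hI2 : FI A φ = FI A (φ * swap u v) ⊓ LinearMap.ker (dl u v) := kback _ _ hI
  have hI3 : ∃ f ∈ FI A (φ * swap u v), dl u v f ≠ 0 := by
    obtain ⟨f, hf, hne⟩ := hI
    exact ⟨f, hf, by simpa [sub_eq_zero] using hne⟩
  by_cases hT : ∃ f ∈ T (α * φ * swap u v) c, f u ≠ f v
  · have hT2 := kback _ _ hT
    rw [show FI A φ = _ from hI2, hT2]
    have := dist_pinch (U := FI A (φ * swap u v)) (W := T (α * φ * swap u v) c) (l := dl u v)
    rcases this with h | h | h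
    · linarith
    · exact absurd hI3 h
    · obtain ⟨f, hf, hne⟩ := hT
      exact absurd ⟨f, hf, by simpa [sub_eq_zero] using hne⟩ h
  · have h1 := dist_T_trans (FI A φ) (α * φ) c ((α * φ) u) ((α * φ) v)
    rw [← key] at h1
    have h2 : dist (FI A φ) (T (α * φ * swap u v) c) + 1 =
        dist (FI A (φ * swap u v)) (T (α * φ * swap u v) c) := by
      have h3 := fr_exact hI3
      rw [← hI2] at h3
      have h4 : FI A φ ⊓ T (α * φ * swap u v) c = FI A (φ * swap u v) ⊓ T (α * φ * swap u v) c := by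
        rw [show FI A φ = _ from hI2]
        ext f
        simp only [Submodule.mem_inf, mem_ker_dl]
        push Not at hT
        constructor
        · rintro ⟨⟨a, b⟩, e⟩
          exact ⟨a, e⟩
        · rintro ⟨a, e⟩
          exact ⟨⟨a, hT f e⟩, e⟩
      unfold dist
      rw [h4]
      omega
    linarith [h1.2]

lemma bad_merge {φ : Perm D} {ε : D → ℤ} {c : D → A} {x : D} {α : Perm D} (hα : Valid ε α)
    (hlt : (Mc ε : ℤ) < 2 * dist (FI A φ) (T (α * φ) c)) (hx : ε x ≠ 0)
    (hs : ¬ φ.SameCycle x (α x)) :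
    Bad (swap x (α x) * φ) (Function.update (Function.update ε x 0) (α x) 0) c := by
  refine ⟨_, valid_zero hα hx, ?_⟩
  have hne : x ≠ α x := fun h => by have := hα.2.1 x; rw [← h] at this; omega
  have hM := Mc_zero hne hx (by rw [hα.2.1]; omega)
  have hσ : α * swap x (α x) * (swap x (α x) * φ) = α * φ := by
    rw [mul_assoc, ← mul_assoc (Equiv.swap _ _), swap_mul_self, one_mul]
  rw [hσ]
  obtain ⟨f0, hf0, hne0⟩ := exists_FI_ne (A := A) hs
  have h1 : FI A (swap x (α x) * φ) = FI A φ ⊓ LinearMap.ker (dl x (α x)) :=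
    T_core_a ⟨f0, hf0, hne0⟩
  have h2 := fr_exact (W := FI A φ) (l := dl x (α x)) ⟨f0, hf0, by simpa [sub_eq_zero] using hne0⟩
  have h3 : FI A (swap x (α x) * φ) ⊓ T (α * φ) c = FI A φ ⊓ T (α * φ) c := by
    rw [h1]
    ext f
    simp only [Submodule.mem_inf, mem_ker_dl]
    constructor
    · rintro ⟨⟨a, b⟩, e⟩
      exact ⟨a, e⟩
    · rintro ⟨a, e⟩
      refine ⟨⟨a, ?_⟩, e⟩
      have k1 := e.1 (φ.symm x)
      have k2 := a.1 (φ.symm x)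
      simp only [Perm.mul_apply, apply_symm_apply] at k1 k2
      rw [k1, k2]
  have h4 : dist (FI A (swap x (α x) * φ)) (T (α * φ) c) + 1 = dist (FI A φ) (T (α * φ) c) := by
    unfold dist
    rw [h3, h1]
    omega
  omega

end Pf

namespace Pf
open Equiv Equiv.Perm
variable {D A : Type} [Group A]

/-- value of a letter -/
noncomputable def ltv (A : Type) [Group A] (e : ℤ) (a : A) : A ∗ Multiplicative ℤ :=
  inr (Multiplicative.ofAdd e) * inl a

/-- value of a list of darts -/
noncomputable def ev (ε : D → ℤ) (c : D → A) (l : List D) : A ∗ Multiplicative ℤ :=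
  (l.map (fun d => ltv A (ε d) (c d))).prod

lemma ev_append (ε : D → ℤ) (c : D → A) (l l' : List D) :
    ev ε c (l ++ l') = ev ε c l * ev ε c l' := by simp [ev]

lemma ev_cons (ε : D → ℤ) (c : D → A) (d : D) (l : List D) :
    ev ε c (d :: l) = ltv A (ε d) (c d) * ev ε c l := by simp [ev]

lemma ev_nil (ε : D → ℤ) (c : D → A) : ev ε c [] = 1 := by simp [ev]

lemma ev_congr {ε ε' : D → ℤ} {c c' : D → A} {l : List D}
    (h : ∀ d ∈ l, ε d = ε' d ∧ c d = c' d) : ev ε c l = ev ε' c' l := by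
  unfold ev
  congr 1
  apply List.map_congr_left
  intro d hd
  rw [(h d hd).1, (h d hd).2]

/-- Britton's lemma for the free product -/
lemma britton {ε : D → ℤ} {c : D → A} {t : List D} (ht : t ≠ []) (hε : ∀ d ∈ t, ε d = 1 ∨ ε d = -1)
    {g a : A} (h : inl g * ev ε c t = inl a) :
    ∃ l₁ x y l₂, t = l₁ ++ x :: y :: l₂ ∧ c x = 1 ∧ ε x = - ε y := by
  by_contra hcon
  push Not at hcon
  let un : D → ℤˣ := fun d => if ε d = 1 then 1 else -1
  have hun : ∀ d ∈ t, ((un d : ℤˣ) : ℤ) = ε d := by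
    intro d hd
    rcases hε d hd with h | h <;> simp [un, h]
  have hchain : (t.map (fun d => (un d, c d))).IsChain
      (fun a b => a.2 ∈ HNNExtension.toSubgroup (⊥ : Subgroup A) ⊥ a.1 → a.1 = b.1) := by
    rw [List.isChain_map, List.isChain_iff_forall_rel_of_append_cons_cons]
    intro x y l₁ l₂ e hx
    have hx1 : c x = 1 := by
      simp only at hx
      rcases Int.units_eq_one_or (un x) with h | h <;> rw [h] at hx <;>
        simpa [HNNExtension.toSubgroup] using hx
    have := hcon l₁ x y l₂ e hx1
    have hx' := hε x (by simp [e])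
    have hy' := hε y (by simp [e])
    simp only [un]
    rcases hx' with h | h <;> rcases hy' with h' | h' <;> simp [h, h'] at this ⊢
  let w : HNNExtension.NormalWord.ReducedWord A ⊥ ⊥ := ⟨g, _, hchain⟩
  let e : (⊥ : Subgroup A) ≃* (⊥ : Subgroup A) := MulEquiv.refl _
  let F : A ∗ Multiplicative ℤ →* HNNExtension A ⊥ ⊥ e :=
    Coprod.lift HNNExtension.of (zpowersHom _ HNNExtension.t)
  have hF : w.prod e = F (inl g * ev ε c t) := by
    simp only [HNNExtension.NormalWord.ReducedWord.prod, w, ev, map_mul, map_list_prod, List.map_map]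
    have e1 : F (inl g) = HNNExtension.of g := by simp [F]
    rw [e1]
    congr 2
    apply List.map_congr_left
    intro d hd
    simp [F, ltv, hun d hd]
  have := HNNExtension.ReducedWord.toList_eq_nil_of_mem_of_range e w (by
    rw [hF, h]
    exact ⟨a, by simp [F]⟩)
  simp [w] at this
  exact ht this

/-- a closed face list -/
def Cl (φ : Perm D) (b : D) (l : List D) : Prop := (l ++ [b]).IsChain (fun x y => φ x = y)

lemma chain_congr {φ φ' : Perm D} {l : List D} {x : D} (h : ∀ a ∈ l, φ' a = φ a)
    (hc : (l ++ [x]).IsChain (fun x y => φ x = y)) : (l ++ [x]).IsChain (fun x y => φ' x = y) := by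
  induction l with
  | nil => simp
  | cons a l ih =>
    have ih' := ih (fun b hb => h b (List.mem_cons_of_mem _ hb))
    cases l with
    | nil =>
      simp at hc ⊢
      rw [h a (by simp), hc]
    | cons b l =>
      simp only [List.cons_append, List.isChain_cons_cons] at hc ih' ⊢
      exact ⟨by rw [h a (by simp), hc.1], ih' hc.2⟩

variable [Fintype D] [DecidableEq D]

lemma red (a : A) (b : D) (n : ℕ) : ∀ (φ : Perm D) (ε : D → ℤ) (c : D → A) (l : List D),
    l.length + l.countP (fun d => ε d ≠ 0) = n → l.Nodup → l.head? = some b → Cl φ b l →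
    ε b = 0 → (∀ d ∈ l, ε d = 0 ∨ ε d = 1 ∨ ε d = -1) → ev ε c l = inl a →
    ∃ (φ' : Perm D) (ε' : D → ℤ) (c' : D → A), (Bad φ ε c ↔ Bad φ' ε' c') ∧
      (∀ d ∈ l, φ' d = d ∧ ε' d = 0 ∧ (d ≠ b → c' d = 1)) ∧ c' b = a ∧
      ∀ d ∉ l, φ' d = φ d ∧ ε' d = ε d ∧ c' d = c d := by
  induction n using Nat.strong_induction_on with
  | _ n ih =>
  intro φ ε c l hn hnd hhd hcl hb hε hev
  by_cases hmk : ∃ y ∈ l, y ≠ b ∧ ε y = 0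
  · obtain ⟨y, hy, hyb, hεy⟩ := hmk
    obtain ⟨s, t2, rfl⟩ := List.append_of_mem hy
    rcases List.eq_nil_or_concat s with rfl | ⟨l1, q, rfl⟩
    · simp at hhd; exact absurd hhd hyb
    simp only [List.concat_eq_append, List.append_assoc, List.cons_append, List.nil_append] at *
    have hz : ∃ z r, t2 ++ [b] = z :: r := by
      cases t2 with
      | nil => exact ⟨_, _, rfl⟩
      | cons z r => exact ⟨z, r ++ [b], rfl⟩
    obtain ⟨z, r, hzr⟩ := hz
    have hcl' := hcl
    unfold Cl at hcl'
    simp only [List.append_assoc, List.cons_append] at hcl'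
    rw [List.isChain_append_cons_cons, hzr, List.isChain_cons_cons] at hcl'
    obtain ⟨hc1, hqy, hyz, hc2⟩ := hcl'
    rw [← hzr] at hc2
    have hqy' : q ≠ y := by
      rintro rfl
      simp [List.nodup_append] at hnd
    have hφ' : ∀ d, d ≠ q → d ≠ y → (swap y (φ y) * φ) d = φ d := by
      intro d h1 h2
      apply swap_ap
      · intro h; exact h1 (φ.injective (h.trans hqy.symm))
      · exact fun h => h2 (φ.injective h)
    have hnd' := hnd
    simp only [List.nodup_append, List.nodup_cons, List.mem_cons, not_or] at hnd'
    have hl1 : ∀ d ∈ l1, d ≠ q ∧ d ≠ y := fun d hd =>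
      ⟨fun h => hnd'.2.2 d hd q (Or.inl rfl) h,
        fun h => hnd'.2.2 d hd y (Or.inr (Or.inl rfl)) h⟩
    have ht2 : ∀ d ∈ t2, d ≠ q ∧ d ≠ y := fun d hd =>
      ⟨fun h => hnd'.2.1.1.2 (h ▸ hd), fun h => hnd'.2.1.2.1 (h ▸ hd)⟩
    have hsub : (l1 ++ q :: t2).Sublist (l1 ++ q :: y :: t2) := by
      apply List.Sublist.append_left
      apply List.Sublist.cons_cons
      exact List.sublist_cons_self _ _
    obtain ⟨φ', ε', c', hB, hin, hcb, hout⟩ := ih _ (by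
        rw [← hn]
        apply add_lt_add_of_lt_of_le
        · simp
        · exact hsub.countP_le) (swap y (φ y) * φ) ε
      (Function.update (Function.update c q (c q * c y)) y 1) (l1 ++ q :: t2) rfl
      (hnd.sublist hsub) (by cases l1 <;> simpa using hhd) (by
        unfold Cl
        rw [List.append_assoc, List.cons_append, hzr, List.isChain_append_cons_cons]
        refine ⟨chain_congr (fun d hd => hφ' d (hl1 d hd).1 (hl1 d hd).2) hc1, ?_, ?_⟩
        · rw [Perm.mul_apply, hqy, swap_apply_left, hyz]
        · rw [← hzr]
          exact chain_congr (fun d hd => hφ' d (ht2 d hd).1 (ht2 d hd).2) hc2)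
      hb (fun d hd => hε d (hsub.subset hd)) (by
        rw [← hev, ev_append, ev_append, ev_cons, ev_cons, ev_cons]
        have e1 : ev ε (Function.update (Function.update c q (c q * c y)) y 1) l1 = ev ε c l1 :=
          ev_congr fun d hd => ⟨rfl, by simp [Function.update_apply, hl1 d hd]⟩
        have e2 : ev ε (Function.update (Function.update c q (c q * c y)) y 1) t2 = ev ε c t2 :=
          ev_congr fun d hd => ⟨rfl, by simp [Function.update_apply, ht2 d hd]⟩
        rw [e1, e2, hεy]
        simp [ltv, Function.update_apply, hqy', mul_assoc])
    refine ⟨φ', ε', c', (bad_absorb hqy hqy' hεy).trans hB, ?_, hcb, ?_⟩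
    · intro d hd
      by_cases hdy : d = y
      · subst hdy
        have := hout d (by
          simp only [List.mem_append, List.mem_cons, not_or]
          exact ⟨fun h => (hl1 d h).2 rfl, hqy'.symm, fun h => (ht2 d h).2 rfl⟩)
        simp [hεy] at this
        simp [this]
      · apply hin
        simp only [List.mem_append, List.mem_cons] at hd ⊢
        tauto
    · intro d hd
      have hd' : d ∉ l1 ++ q :: t2 := fun h => hd (hsub.subset h)
      simp only [List.mem_append, List.mem_cons, not_or] at hd
      have := hout d hd'
      rw [hφ' d hd.2.1 hd.2.2.1] at this
      simpa [Function.update_apply, hd.2.1, hd.2.2.1] using this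
  · push Not at hmk
    obtain ⟨t, rfl⟩ : ∃ t, l = b :: t := by
      cases l with
      | nil => simp at hhd
      | cons x t => simp at hhd; exact ⟨t, by rw [hhd]⟩
    have hbt : b ∉ t := (List.nodup_cons.1 hnd).1
    by_cases ht : t = []
    · subst ht
      simp [Cl] at hcl
      simp only [ev, List.map_cons, List.map_nil, List.prod_cons, List.prod_nil, ltv, hb, ofAdd_zero,
        map_one, one_mul, mul_one] at hev
      refine ⟨φ, ε, c, Iff.rfl, ?_, Coprod.inl_injective hev, fun _ _ => ⟨rfl, rfl, rfl⟩⟩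
      intro d hd
      simp at hd
      subst hd
      exact ⟨hcl, hb, fun h => absurd rfl h⟩
    · have hεt : ∀ d ∈ t, ε d = 1 ∨ ε d = -1 := fun d hd => by
        rcases hε d (List.mem_cons_of_mem _ hd) with h | h
        · exact absurd h (hmk d (List.mem_cons_of_mem _ hd) (fun h => hbt (h ▸ hd)))
        · exact h
      obtain ⟨l₁, x, y, l₂, rfl, hcx, hxy⟩ := britton (c := c) (g := c b) ht hεt (by
        rw [← hev, ev_cons, ltv, hb]; simp)
      have hy1 := hεt y (by simp)
      have hy0 : ε y ≠ 0 := by rcases hy1 with h | h <;> omega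
      have hx0 : ε x ≠ 0 := by rcases hy1 with h | h <;> omega
      have hφx : φ x = y := by
        exact List.isChain_iff_forall_rel_of_append_cons_cons.1 hcl
          (show b :: (l₁ ++ x :: y :: l₂) ++ [b] = (b :: l₁) ++ x :: y :: (l₂ ++ [b]) by simp)
      have hnex : x ≠ y := by rintro rfl; omega
      set ε₁ := Function.update (Function.update ε x 0) y 0 with hε₁
      have hε₁' : ∀ d, d ≠ x → d ≠ y → ε₁ d = ε d := fun d h1 h2 => by
        simp [hε₁, Function.update_apply, h1, h2]
      have hx1 : ε₁ x = 0 := by simp [hε₁, Function.update_apply]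
      have hy1 : ε₁ y = 0 := by simp [hε₁, Function.update_apply]
      have hnd' := hnd
      simp only [List.nodup_append, List.nodup_cons, List.mem_cons, not_or, List.mem_append] at hnd'
      obtain ⟨⟨-, n1, n2, -⟩, -, ⟨⟨-, n3⟩, n4, -⟩, n5⟩ := hnd'
      have m1 : ∀ d ∈ l₁, ε₁ d = ε d := fun d hd => hε₁' d (fun h => n5 d hd x (Or.inl rfl) h)
        (fun h => n5 d hd y (Or.inr (Or.inl rfl)) h)
      have m2 : ∀ d ∈ l₂, ε₁ d = ε d := fun d hd => hε₁' d (fun h => n3 (h ▸ hd))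
        (fun h => n4 (h ▸ hd))
      obtain ⟨φ', ε', c', hB, hin, hcb, hout⟩ := ih _ (by
          rw [← hn]
          apply add_lt_add_of_le_of_lt (le_refl (b :: (l₁ ++ x :: y :: l₂)).length)
          simp only [List.countP_cons, List.countP_append]
          have k1 : l₁.countP (fun d => ε₁ d ≠ 0) = l₁.countP (fun d => ε d ≠ 0) :=
            List.countP_congr fun d hd => by simp [m1 d hd]
          have k2 : l₂.countP (fun d => ε₁ d ≠ 0) = l₂.countP (fun d => ε d ≠ 0) :=
            List.countP_congr fun d hd => by simp [m2 d hd]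
          rw [k1, k2, hx1, hy1, hε₁' b n1 n2]
          simp [hx0, hy0]) φ ε₁ c (b :: (l₁ ++ x :: y :: l₂)) rfl hnd hhd hcl
          (by rw [hε₁' b n1 n2, hb]) (fun d hd => by
            by_cases h1 : d = x
            · subst h1; exact Or.inl hx1
            by_cases h2 : d = y
            · subst h2; exact Or.inl hy1
            rw [hε₁' d h1 h2]
            exact hε d hd) (by
            rw [← hev]
            simp only [ev_cons, ev_append]
            rw [ev_congr (l := l₁) (fun d hd => ⟨m1 d hd, rfl⟩),
              ev_congr (l := l₂) (fun d hd => ⟨m2 d hd, rfl⟩), hε₁' b n1 n2, hx1, hy1, hxy, hcx]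
            simp only [ltv, map_one, mul_one, ofAdd_zero, one_mul, ofAdd_neg, map_inv]
            group)
      refine ⟨φ', ε', c', (bad_zero hφx hcx hxy hy0).trans hB, hin, hcb, ?_⟩
      intro d hd
      have := hout d hd
      simp only [List.mem_append, List.mem_cons, not_or] at hd
      rwa [hε₁' d hd.2.2.1 hd.2.2.2.1] at this

end Pf

namespace Pf
open Equiv Equiv.Perm
variable {D A : Type} [Group A]

/-- normalized relator data -/
structure WD (A : Type) [Group A] (k : ℕ) where
  ew : ZMod k → ℤ
  aw : ZMod k → A
  C : ZMod k → ℤ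
  hk : 0 < k
  hew : ∀ i, ew i = 1 ∨ ew i = -1
  hred : ∀ i, ew (i + 1) = - ew i → aw i ≠ 1
  hC : ∀ i, C (i + 1) = C i + 1 - k * ew (i + 1)
  hC0 : ∀ i, ((C i : ℤ) : ZMod k) = i

/-- isolated dart -/
def IsIso (φ : Perm D) (ε : D → ℤ) (c : D → A) (d : D) : Prop := φ d = d ∧ ε d = 0 ∧ c d = 1

/-- relator dart -/
structure IsRel {k : ℕ} (w : WD A k) (m : ℕ) (s : D → Bool) (j : D → ZMod k)
    (φ : Perm D) (ε : D → ℤ) (c : D → A) (d : D) : Prop where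
  hs : s (φ d) = s d
  pos : s d = true → j (φ d) = j d + 1 ∧ ε d = w.ew (j d) ∧ c d = w.aw (j d)
  neg : s d = false → j (φ d) = j d - 1 ∧ ε d = - w.ew (j d) ∧ c d = (w.aw (j d - 1))⁻¹
  per : Function.minimalPeriod φ d = m * k

/-- context for the counting argument -/
structure Ctx {k : ℕ} (w : WD A k) (m : ℕ) (s : D → Bool) (j : D → ZMod k)
    (φ : Perm D) (ε : D → ℤ) (c : D → A) (α : Perm D) : Prop where
  hm : 2 ≤ m
  hR : ∀ d, IsIso φ ε c d ∨ IsRel w m s j φ ε c d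
  hα : Valid ε α
  star : ∀ x, ε x ≠ 0 → j (α x) ≠ j x

namespace WD
variable {k : ℕ} (w : WD A k)

/-- height -/
def τ (i : ZMod k) : ℤ := w.C i + if w.ew i = 1 then (k : ℤ) else 0

lemma τ_succ (i : ZMod k) : w.τ (i + 1) = w.C i + 1 + if w.ew (i + 1) = -1 then (k : ℤ) else 0 := by
  unfold τ
  rw [w.hC]
  rcases w.hew (i + 1) with h | h <;> rw [h] <;> simp

lemma C_inj : Function.Injective w.C := fun a b h => by
  rw [← w.hC0 a, ← w.hC0 b, h]

lemma τ_inj : Function.Injective w.τ := fun a b h => by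
  have : ∀ i, ((w.τ i : ℤ) : ZMod k) = i := by
    intro i
    unfold τ
    split_ifs <;> simp [w.hC0]
  rw [← this a, ← this b, h]

lemma ew_ne (i : ZMod k) : w.ew i ≠ 0 := by rcases w.hew i with h | h <;> omega

end WD

lemma IsRel.ne {k : ℕ} {w : WD A k} {m : ℕ} {s : D → Bool} {j : D → ZMod k}
    {φ : Perm D} {ε : D → ℤ} {c : D → A} {d : D} (h : IsRel w m s j φ ε c d) : ε d ≠ 0 := by
  cases hs : s d
  · rw [(h.neg hs).2.1]; have := w.ew_ne (j d); omega
  · rw [(h.pos hs).2.1]; exact w.ew_ne _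

namespace Ctx
variable {k : ℕ} {w : WD A k} {m : ℕ} {s : D → Bool} {j : D → ZMod k}
    {φ : Perm D} {ε : D → ℤ} {c : D → A} {α : Perm D} (h : Ctx w m s j φ ε c α)
include h

lemma rel {d : D} (hd : ε d ≠ 0) : IsRel w m s j φ ε c d :=
  (h.hR d).resolve_left fun h' => hd h'.2.1

lemma iso {d : D} (hd : ε d = 0) : IsIso φ ε c d :=
  (h.hR d).resolve_right fun h' => h'.ne hd

lemma φR {d : D} : ε (φ d) ≠ 0 ↔ ε d ≠ 0 := by
  constructor
  · intro h1 h2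
    rw [(h.iso h2).1] at h1
    exact h1 h2
  · intro h1 h2
    have := φ.injective (h.iso h2).1
    rw [this] at h2
    exact h1 h2

lemma αR {d : D} : ε (α d) ≠ 0 ↔ ε d ≠ 0 := by
  rw [h.hα.2.1]; simp

lemma sφ (d : D) : s (φ d) = s d := by
  rcases h.hR d with h' | h'
  · rw [h'.1]
  · exact h'.hs

/-- previous letter of a corner -/
def prev (_ : Ctx w m s j φ ε c α) (d : D) : D := if s d then d else φ d
/-- next letter of a corner -/
def next (_ : Ctx w m s j φ ε c α) (d : D) : D := if s d then φ d else d
/-- index of a corner -/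
def κ (h : Ctx w m s j φ ε c α) (d : D) : ZMod k := j (h.prev d)
/-- top letters -/
def top (_ : Ctx w m s j φ ε c α) (e : D) : Prop := w.τ (j (α e)) < w.τ (j e)

lemma end_τ {d : D} (hd : ε d ≠ 0) : w.τ (j (φ d)) =
    w.C (h.κ d) + (if s d then 1 else 0) + if ε (φ d) = -1 then (k : ℤ) else 0 := by
  have h1 := h.rel hd
  have h2 := h.rel (h.φR.2 hd)
  have hs2 := h.sφ d
  cases hs : s d
  · rw [hs] at hs2
    simp only [κ, prev, hs, WD.τ, (h2.neg hs2).2.1]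
    simp
  · rw [hs] at hs2
    simp only [κ, prev, hs, (h2.pos hs2).2.1, if_true, (h1.pos hs).1]
    rw [w.τ_succ]

lemma start_τ {d : D} (hd : ε d ≠ 0) : w.τ (j d) =
    w.C (h.κ d) + (if s d then 0 else 1) + if ε d = 1 then (k : ℤ) else 0 := by
  have h1 := h.rel hd
  cases hs : s d
  · simp only [κ, prev, hs]
    simp only [Bool.false_eq_true, if_false, (h1.neg hs).1, (h1.neg hs).2.1]
    have := w.τ_succ (j d - 1)
    rw [sub_add_cancel] at this
    rw [this]
    congr 2
    rw [eq_iff_iff]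
    omega
  · simp only [κ, prev, hs, (h1.pos hs).2.1, if_true, WD.τ]
    simp

/-- `σ`-step comparison -/
lemma step {d : D} (hd : ε d ≠ 0) :
    (h.top (φ d) ↔ w.C (h.κ ((α * φ) d)) + (if s ((α * φ) d) then 0 else 1) <
      w.C (h.κ d) + (if s d then 1 else 0)) ∧
    (h.top ((α * φ) d) ↔ w.C (h.κ d) + (if s d then 1 else 0) <
      w.C (h.κ ((α * φ) d)) + (if s ((α * φ) d) then 0 else 1)) ∧
    w.C (h.κ d) + (if s d then (1 : ℤ) else 0) ≠
      w.C (h.κ ((α * φ) d)) + (if s ((α * φ) d) then 0 else 1) := by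
  have hφ := h.φR.2 hd
  have hσ : ε ((α * φ) d) ≠ 0 := h.αR.2 hφ
  have e1 := h.end_τ hd
  have e2 := h.start_τ hσ
  have e3 : ε ((α * φ) d) = - ε (φ d) := h.hα.2.1 _
  have e4 : (if ε ((α * φ) d) = 1 then (k : ℤ) else 0) = if ε (φ d) = -1 then (k : ℤ) else 0 := by
    congr 1
    rw [e3, eq_iff_iff]
    omega
  rw [e4] at e2
  have e5 : α ((α * φ) d) = φ d := h.hα.1 _
  have e6 : w.τ (j ((α * φ) d)) ≠ w.τ (j (φ d)) := fun he => h.star _ hφ (w.τ_inj he)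
  unfold top
  rw [e5]
  change (w.τ (j ((α * φ) d)) < _ ↔ _) ∧ _
  refine ⟨?_, ?_, ?_⟩
  · rw [e1, e2]; constructor <;> intro <;> linarith
  · rw [e1, e2]; constructor <;> intro <;> linarith
  · intro he; apply e6; rw [e1, e2, he]

/-- good corner -/
def G (h : Ctx w m s j φ ε c α) (d : D) : Prop := ε d ≠ 0 ∧ h.top (h.next d) ∧ h.top (h.prev d)
/-- bad corner -/
def B (h : Ctx w m s j φ ε c α) (d : D) : Prop := ε d ≠ 0 ∧ h.top (h.next d) ∧ ¬ h.top (h.prev d)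

lemma σR {d e : D} (hs : (α * φ).SameCycle d e) : ε e ≠ 0 ↔ ε d ≠ 0 := by
  have := inv_sameCycle (σ := α * φ) (f := fun d => ε d ≠ 0) (fun d => by
    rw [eq_iff_iff, Perm.mul_apply, h.αR, h.φR]) hs
  simpa using this

variable [Finite D]

lemma max_corner {d : D} (hd : ε d ≠ 0)
    (hmax : ∀ e, (α * φ).SameCycle d e → w.C (h.κ e) ≤ w.C (h.κ d))
    (hG : ∀ e, (α * φ).SameCycle d e → ¬ h.G e) :
    h.B d ∧ (s d = true → ∀ e, (α * φ) e = d → h.κ e = h.κ d ∧ s e = s d) ∧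
      (s d = false → h.κ ((α * φ) d) = h.κ d ∧ s ((α * φ) d) = s d) := by
  have hg := hG d (SameCycle.refl _ _)
  have hn : h.top (h.next d) → h.B d := fun ht => ⟨hd, ht, fun hp => hg ⟨hd, ht, hp⟩⟩
  obtain ⟨e, rfl⟩ := (α * φ).surjective d
  have hse : (α * φ).SameCycle ((α * φ) e) e := sameCycle_apply_left.2 (SameCycle.refl _ _)
  have he : ε e ≠ 0 := (h.σR hse).2 hd
  have s1 := h.step he
  have s2 := h.step hd
  have m1 := hmax e hse
  have m2 := hmax ((α * φ) ((α * φ) e)) (sameCycle_apply_right.2 (SameCycle.refl _ _))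
  generalize hx : (α * φ) e = x at *
  generalize hy : (α * φ) x = y at *
  cases hs : s x
  · have hb : h.B x := by
      apply hn
      simp only [next, hs, Bool.false_eq_true, if_false]
      rw [s1.2.1]
      have := s1.2.2
      simp only [hs, Bool.false_eq_true, if_false] at this ⊢
      split_ifs at this ⊢ <;> omega
    refine ⟨hb, by simp, fun _ => ?_⟩
    have hp := hb.2.2
    simp only [prev, hs, Bool.false_eq_true, if_false] at hp
    rw [s2.1] at hp
    have := s2.2.2
    simp only [hs, Bool.false_eq_true, if_false] at hp this
    cases hsy : s y
    · refine ⟨w.C_inj ?_, rfl⟩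
      simp only [hsy, Bool.false_eq_true, if_false] at hp this
      omega
    · exfalso
      simp only [hsy, if_true] at hp this
      omega
  · have hb : h.B x := by
      apply hn
      simp only [next, hs, if_true]
      rw [s2.1]
      have := s2.2.2
      simp only [hs, if_true] at this ⊢
      split_ifs at this ⊢ <;> omega
    refine ⟨hb, fun _ e' he' => ?_, by simp⟩
    rw [← hx] at he'
    have := (α * φ).injective he'
    subst this
    have hp := hb.2.2
    simp only [prev, hs, if_true] at hp
    rw [s1.2.1] at hp
    have := s1.2.2
    simp only [hs, if_true] at hp this
    cases hsy : s e'
    · exfalso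
      simp only [hsy, Bool.false_eq_true, if_false] at hp this
      omega
    · refine ⟨w.C_inj ?_, rfl⟩
      simp only [hsy, if_true] at hp this
      omega

/-- every vertex has a good corner or only bad ones of the same type -/
lemma vertex {d : D} (hd : ε d ≠ 0) (hG : ∀ e, (α * φ).SameCycle d e → ¬ h.G e) :
    ∃ d', (α * φ).SameCycle d d' ∧ ∀ e, (α * φ).SameCycle d e → h.B e ∧ h.κ e = h.κ d' ∧ s e = s d' := by
  classical
  obtain ⟨d', hd', hmax⟩ := Set.exists_max_image {e | (α * φ).SameCycle d e}
    (fun e => w.C (h.κ e)) (Set.toFinite _) ⟨d, SameCycle.refl _ _⟩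
  simp only [Set.mem_ofPred_eq] at hd' hmax
  refine ⟨d', hd', ?_⟩
  have key : ∀ e, (α * φ).SameCycle d e → h.κ e = h.κ d' → _ := fun e he hk =>
    h.max_corner ((h.σR he).2 hd) (fun e' he' => by rw [hk]; exact hmax e' (he.trans he'))
      (fun e' he' => hG e' (he.trans he'))
  have hall : ∀ e, (α * φ).SameCycle d' e → h.κ e = h.κ d' ∧ s e = s d' := by
    cases hs : s d'
    · intro e he
      obtain ⟨n, rfl⟩ := he.exists_nat_pow_eq
      induction n with
      | zero => simp [hs]
      | succ n ih =>
        have hn : (α * φ).SameCycle d' (((α * φ) ^ n) d') := ⟨n, by simp⟩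
        obtain ⟨i1, i2⟩ := ih hn
        have := (key _ (hd'.trans hn) i1).2.2 i2
        rw [pow_succ', Perm.mul_apply, this.1, this.2]
        exact ⟨i1, i2⟩
    · intro e he
      obtain ⟨n, hn⟩ := he.symm.exists_nat_pow_eq
      induction n generalizing e with
      | zero => simp at hn; simp [hn, hs]
      | succ n ih =>
        rw [pow_succ, Perm.mul_apply] at hn
        have he' : (α * φ).SameCycle d' ((α * φ) e) := by rwa [sameCycle_apply_right]
        obtain ⟨i1, i2⟩ := ih _ he' hn
        have := (key _ (hd'.trans he') i1).2.1 i2 e rfl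
        rw [this.1, this.2]
        exact ⟨i1, i2⟩
  intro e he
  have := hall e (hd'.symm.trans he)
  exact ⟨(key e he this.1).1, this.1, this.2⟩

/-- trivial vertices without good corner have two bad corners -/
lemma vertex2 {d : D} (hd : ε d ≠ 0) (ht : Triv (α * φ) c d)
    (hG : ∀ e, (α * φ).SameCycle d e → ¬ h.G e) :
    (α * φ) d ≠ d ∧ h.B d ∧ h.B ((α * φ) d) := by
  obtain ⟨d', hd', hall⟩ := h.vertex hd hG
  refine ⟨fun he => ?_, (hall d (SameCycle.refl _ _)).1,
    (hall _ (by simp only [sameCycle_apply_right]; exact SameCycle.refl _ _)).1⟩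
  obtain ⟨g, hg⟩ := ht
  have hc := hg d (SameCycle.refl _ _)
  rw [he] at hc
  have hc1 : c d = 1 := by simpa using hc
  have hε : ε d = - ε (φ d) := by
    rw [← h.hα.2.1, ← Perm.mul_apply, he]
  have h1 := h.rel hd
  have h2 := h.rel (h.φR.2 hd)
  have hs2 := h.sφ d
  cases hs : s d
  · rw [hs] at hs2
    have a1 := h1.neg hs
    have a2 := h2.neg hs2
    apply w.hred (j d - 1)
    · rw [sub_add_cancel]
      rw [a1.1] at a2
      rw [← a1.1] at a2 ⊢
      rw [a1.1] at a2 ⊢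
      omega
    · rw [a1.2.2] at hc1
      simpa using hc1
  · rw [hs] at hs2
    have a1 := h1.pos hs
    have a2 := h2.pos hs2
    apply w.hred (j d)
    · rw [a1.1] at a2
      omega
    · rw [a1.2.2] at hc1
      exact hc1

end Ctx
end Pf

namespace Pf
open Equiv Equiv.Perm Module
variable {D A : Type} [Group A] [Fintype D]

open Classical in
lemma count (W : Submodule ℚ (D → ℚ)) (σ : Perm D) (wt : D → ℕ) (n : ℕ)
    (hinv : ∀ f ∈ W, ∀ d, f (σ d) = f d)
    (hwt : ∀ f ∈ W, ∀ d, f d ≠ 0 → n ≤ ∑ e ∈ Finset.univ.filter (fun e => σ.SameCycle d e), wt e) :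
    n * finrank ℚ W ≤ ∑ e, wt e := by
  let Q := Quotient (SameCycle.setoid σ)
  let mk : D → Q := Quotient.mk (SameCycle.setoid σ)
  have hout : ∀ d, σ.SameCycle (mk d).out d := fun d =>
    Quotient.mk_out (s := SameCycle.setoid σ) d
  let P : Finset Q := Finset.univ.filter (fun q => ∃ f ∈ W, f q.out ≠ 0)
  have h1 : finrank ℚ W ≤ P.card := by
    let F : W →ₗ[ℚ] (P → ℚ) :=
      { toFun := fun f q => (f : D → ℚ) q.1.out
        map_add' := fun f g => rfl
        map_smul' := fun a f => rfl }
    have hF : Function.Injective F := by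
      rw [← LinearMap.ker_eq_bot, LinearMap.ker_eq_bot']
      intro f hf
      ext d
      by_contra hd
      have hd' : (f : D → ℚ) (mk d).out ≠ 0 := by
        rw [← inv_sameCycle (hinv f f.2) (hout d)]
        exact hd
      have hq : mk d ∈ P := Finset.mem_filter.2 ⟨Finset.mem_univ _, f, f.2, hd'⟩
      exact hd' (congrFun hf ⟨mk d, hq⟩)
    have := LinearMap.finrank_le_finrank_of_injective hF
    simpa using this
  have h2 : ∑ e, wt e = ∑ q : Q, ∑ e ∈ Finset.univ.filter (fun e => mk e = q), wt e :=
    (Finset.sum_fiberwise _ _ _).symm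
  rw [h2]
  calc n * finrank ℚ W ≤ n * P.card := Nat.mul_le_mul_left _ h1
    _ = ∑ q ∈ P, n := by rw [Finset.sum_const, smul_eq_mul, mul_comm]
    _ ≤ ∑ q ∈ P, ∑ e ∈ Finset.univ.filter (fun e => mk e = q), wt e := by
        apply Finset.sum_le_sum
        intro q hq
        obtain ⟨f, hf, hne⟩ := (Finset.mem_filter.1 hq).2
        have hfe : Finset.univ.filter (fun e => mk e = q) =
            Finset.univ.filter (fun e => σ.SameCycle q.out e) := by
          ext e
          simp only [Finset.mem_filter, Finset.mem_univ, true_and]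
          constructor
          · rintro rfl; exact hout e
          · intro he
            rw [← Quotient.out_eq q]
            exact (Quotient.sound (s := SameCycle.setoid σ) he).symm
        rw [hfe]
        exact hwt f hf _ hne
    _ ≤ _ := Finset.sum_le_univ_sum_of_nonneg (fun q => Nat.zero_le _)

/-- functions supported on the support of `ε` -/
def KS (ε : D → ℤ) : Submodule ℚ (D → ℚ) where
  carrier := {f | ∀ d, ε d = 0 → f d = 0}
  add_mem' := fun {f g} hf hg d hd => by simp [hf d hd, hg d hd]
  zero_mem' := fun d _ => rfl
  smul_mem' := fun a f hf d hd => by simp [hf d hd]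

/-- functions supported off the support of `ε` -/
def ZS (ε : D → ℤ) : Submodule ℚ (D → ℚ) where
  carrier := {f | ∀ d, ε d ≠ 0 → f d = 0}
  add_mem' := fun {f g} hf hg d hd => by simp [hf d hd, hg d hd]
  zero_mem' := fun d _ => rfl
  smul_mem' := fun a f hf d hd => by simp [hf d hd]

lemma fr_ZS {ε : D → ℤ} {U : Submodule ℚ (D → ℚ)} (hU : ZS ε ≤ U) :
    finrank ℚ U ≤ finrank ℚ (ZS ε) + finrank ℚ (U ⊓ KS ε : Submodule ℚ (D → ℚ)) := by
  have : U ≤ ZS ε ⊔ (U ⊓ KS ε) := by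
    intro f hf
    have h1 : (fun d => if ε d = 0 then f d else 0) ∈ ZS ε := fun d hd => by simp [hd]
    have h2 : f - (fun d => if ε d = 0 then f d else 0) ∈ U ⊓ KS ε :=
      ⟨U.sub_mem hf (hU h1), fun d hd => by simp [hd]⟩
    rw [Submodule.mem_sup]
    exact ⟨_, h1, _, h2, by simp⟩
  exact (Submodule.finrank_mono this).trans (Submodule.finrank_add_le_finrank_add_finrank _ _)

lemma dist_le_ZS {ε : D → ℤ} {U W : Submodule ℚ (D → ℚ)} (hU : ZS ε ≤ U) (hW : ZS ε ≤ W) :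
    dist U W ≤ finrank ℚ (U ⊓ KS ε : Submodule ℚ (D → ℚ)) +
      finrank ℚ (W ⊓ KS ε : Submodule ℚ (D → ℚ)) := by
  have h1 := fr_ZS hU
  have h2 := fr_ZS hW
  have h3 := Submodule.finrank_mono (le_inf hU hW)
  unfold dist
  omega

namespace Ctx
variable {k : ℕ} {w : WD A k} {m : ℕ} {s : D → Bool} {j : D → ZMod k}
    {φ : Perm D} {ε : D → ℤ} {c : D → A} {α : Perm D} (h : Ctx w m s j φ ε c α)
include h

/-- time step -/
def θ (_ : Ctx w m s j φ ε c α) (e : D) : D := if s e then φ e else φ.symm e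

lemma sφ' (d : D) : s (φ.symm d) = s d := by
  have := h.sφ (φ.symm d)
  rw [apply_symm_apply] at this
  exact this.symm

lemma φR' {d : D} : ε (φ.symm d) ≠ 0 ↔ ε d ≠ 0 := by
  have := h.φR (d := φ.symm d)
  rw [apply_symm_apply] at this
  exact this.symm

lemma θs (e : D) : s (h.θ e) = s e := by
  unfold θ
  split_ifs
  · exact h.sφ e
  · exact h.sφ' e

lemma θ_inj : Function.Injective h.θ := by
  intro a b hab
  have hs : s a = s b := by rw [← h.θs a, hab, h.θs]
  unfold θ at hab
  rw [hs] at hab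
  split_ifs at hab
  · exact φ.injective hab
  · exact φ.symm.injective hab

lemma θR {e : D} (he : ε e ≠ 0) : ε (h.θ e) ≠ 0 := by
  unfold θ
  split_ifs
  · exact h.φR.2 he
  · exact h.φR'.2 he

lemma θj {e : D} (he : ε e ≠ 0) : j (h.θ e) = j e + 1 := by
  unfold θ
  cases hs : s e
  · have h1 := h.rel (h.φR'.2 he)
    have := (h1.neg (by rw [h.sφ', hs])).1
    rw [apply_symm_apply] at this
    simp [this]
  · simp [((h.rel he).pos hs).1]

lemma θi {e : D} (he : ε e ≠ 0) (n : ℕ) : ε (h.θ^[n] e) ≠ 0 ∧ s (h.θ^[n] e) = s e ∧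
    j (h.θ^[n] e) = j e + n := by
  induction n with
  | zero => simp [he]
  | succ n ih =>
    rw [Function.iterate_succ_apply']
    refine ⟨h.θR ih.1, by rw [h.θs, ih.2.1], ?_⟩
    rw [h.θj ih.1, ih.2.2]
    push_cast
    ring

/-- corner with given previous letter -/
def cor (_ : Ctx w m s j φ ε c α) (p : D) : D := if s p then p else φ.symm p

lemma cor_spec {p : D} (hp : ε p ≠ 0) : ε (h.cor p) ≠ 0 ∧ h.prev (h.cor p) = p ∧
    h.next (h.cor p) = h.θ p := by
  unfold cor prev next θ
  cases hs : s p
  · simp [h.sφ', hs, h.φR'.2 hp]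
  · simp [hs, hp]

open Classical in
/-- number of letters of minimal height is at most the number of bad corners -/
lemma F_le_B {fm fM : ZMod k} (hmin : ∀ i, w.τ fm ≤ w.τ i) (hmax : ∀ i, w.τ i ≤ w.τ fM) :
    (Finset.univ.filter (fun d => ε d ≠ 0 ∧ j d = fm)).card ≤
    (Finset.univ.filter (fun d => h.B d)).card := by
  have : NeZero k := ⟨w.hk.ne'⟩
  have hbot : ∀ e, j e = fm → ¬ h.top e := fun e he ht => by
    unfold top at ht
    rw [he] at ht
    exact absurd (hmin (j (α e))) (by omega)
  have htop : ∀ e, ε e ≠ 0 → j e = fM → h.top e := fun e he hj => by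
    unfold top
    rw [hj]
    refine lt_of_le_of_ne (hmax _) fun h' => ?_
    apply h.star e he
    rw [w.τ_inj h', hj]
  have hex : ∀ e, ε e ≠ 0 → j e = fm → ∃ n < k, ¬ h.top (h.θ^[n] e) ∧ h.top (h.θ^[n + 1] e) := by
    intro e he hj
    have : ∃ n, h.top (h.θ^[n] e) := by
      refine ⟨(fM - fm).val, htop _ (h.θi he _).1 ?_⟩
      rw [(h.θi he _).2.2, hj]
      simp
    have hle : Nat.find this < k := lt_of_le_of_lt (Nat.find_min' this (by
        apply htop _ (h.θi he _).1
        rw [(h.θi he _).2.2, hj]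
        simp : h.top (h.θ^[(fM - fm).val] e))) (ZMod.val_lt _)
    have h0 : Nat.find this ≠ 0 := by
      intro h0
      have := Nat.find_spec this
      rw [h0] at this
      exact hbot e hj this
    refine ⟨Nat.find this - 1, by omega, Nat.find_min this (by omega), ?_⟩
    rw [Nat.sub_add_cancel (by omega)]
    exact Nat.find_spec this
  choose! n hn using hex
  apply Finset.card_le_card_of_injOn (fun e => h.cor (h.θ^[n e] e))
  · intro e he
    simp only [Finset.coe_filter, Finset.mem_univ, true_and, Set.mem_ofPred_eq] at he ⊢
    obtain ⟨h1, h2, h3⟩ := hn e he.1 he.2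
    have hc := h.cor_spec (h.θi he.1 (n e)).1
    refine ⟨hc.1, ?_, ?_⟩
    · rw [hc.2.2, ← Function.iterate_succ_apply' h.θ]
      exact h3
    · rw [hc.2.1]; exact h2
  · intro e he e' he' heq
    simp only [Finset.coe_filter, Finset.mem_univ, true_and, Set.mem_ofPred_eq] at he he' heq
    have hc := h.cor_spec (h.θi he.1 (n e)).1
    have hc' := h.cor_spec (h.θi he'.1 (n e')).1
    have h1 : h.θ^[n e] e = h.θ^[n e'] e' := by rw [← hc.2.1, heq, hc'.2.1]
    have h2 := (h.θi he.1 (n e)).2.2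
    rw [h1, (h.θi he'.1 (n e')).2.2, he.2, he'.2, add_right_inj] at h2
    have h3 : n e = n e' := by
      have := congrArg ZMod.val h2
      rw [ZMod.val_natCast_of_lt (hn e he.1 he.2).1, ZMod.val_natCast_of_lt (hn e' he'.1 he'.2).1] at this
      exact this.symm
    rw [h3] at h1
    exact h.θ_inj.iterate _ h1

open Classical in
lemma GB_le [DecidableEq D] : 2 * ((Finset.univ.filter (fun d => h.G d)).card +
    (Finset.univ.filter (fun d => h.B d)).card) ≤ Mc ε := by
  have hinj : Set.InjOn h.next {d | ε d ≠ 0} := by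
    intro a ha b hb hab
    have hs : s a = s b := by
      have : ∀ x, s (h.next x) = s x := fun x => by
        unfold next; split_ifs <;> simp [h.sφ]
      rw [← this a, hab, this]
    unfold next at hab
    rw [hs] at hab
    split_ifs at hab
    · exact φ.injective hab
    · exact hab
  have h1 : (Finset.univ.filter (fun d => h.G d)).card + (Finset.univ.filter (fun d => h.B d)).card
      ≤ (Finset.univ.filter (fun d => ε d ≠ 0 ∧ h.top d)).card := by
    rw [← Finset.card_union_of_disjoint]
    · apply Finset.card_le_card_of_injOn h.next
      · intro d hd
        simp only [Finset.coe_union, Finset.coe_filter, Finset.mem_univ, true_and,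
          Set.mem_union, Set.mem_ofPred_eq] at hd ⊢
        have hd' : ε d ≠ 0 ∧ h.top (h.next d) := by
          rcases hd with hd | hd
          · exact ⟨hd.1, hd.2.1⟩
          · exact ⟨hd.1, hd.2.1⟩
        refine ⟨?_, hd'.2⟩
        unfold next
        split_ifs
        · exact h.φR.2 hd'.1
        · exact hd'.1
      · apply hinj.mono
        intro d hd
        simp only [Finset.coe_union, Finset.coe_filter, Finset.mem_univ, true_and,
          Set.mem_union, Set.mem_ofPred_eq] at hd ⊢
        rcases hd with hd | hd
        · exact hd.1
        · exact hd.1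
    · rw [Finset.disjoint_filter]
      intro d _ hg hb
      exact hb.2.2 hg.2.2
  have h2 : (Finset.univ.filter (fun d => ε d ≠ 0 ∧ h.top d)).card ≤
      (Finset.univ.filter (fun d => ε d ≠ 0 ∧ ¬ h.top d)).card := by
    apply Finset.card_le_card_of_injOn α
    · intro d hd
      simp only [Finset.coe_filter, Finset.mem_univ, true_and, Set.mem_ofPred_eq] at hd ⊢
      refine ⟨h.αR.2 hd.1, ?_⟩
      have := hd.2
      unfold top at this ⊢
      rw [h.hα.1]
      omega
    · exact α.injective.injOn
  have h3 : (Finset.univ.filter (fun d => ε d ≠ 0 ∧ h.top d)).card +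
      (Finset.univ.filter (fun d => ε d ≠ 0 ∧ ¬ h.top d)).card = Mc ε := by
    unfold Mc
    rw [← Finset.card_union_of_disjoint]
    · congr 1
      ext d
      simp only [Finset.mem_union, Finset.mem_filter, Finset.mem_univ, true_and]
      tauto
    · rw [Finset.disjoint_filter]
      tauto
  omega

lemma φi {d : D} (hd : ε d ≠ 0) (n : ℕ) : ε (φ^[n] d) ≠ 0 ∧ s (φ^[n] d) = s d ∧
    (s d = true → j (φ^[n] d) = j d + n) ∧ (s d = false → j (φ^[n] d) = j d - n) := by
  induction n with
  | zero => simp [hd]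
  | succ n ih =>
    rw [Function.iterate_succ_apply']
    have hr := h.rel ih.1
    refine ⟨h.φR.2 ih.1, by rw [h.sφ, ih.2.1], fun hs => ?_, fun hs => ?_⟩
    · rw [(hr.pos (ih.2.1.trans hs)).1, ih.2.2.1 hs]; push_cast; ring
    · rw [(hr.neg (ih.2.1.trans hs)).1, ih.2.2.2 hs]; push_cast; ring

lemma face_two {d : D} (hd : ε d ≠ 0) (f : ZMod k) : ∃ x y, x ≠ y ∧ φ.SameCycle d x ∧
    φ.SameCycle d y ∧ j x = f ∧ j y = f ∧ ε x ≠ 0 ∧ ε y ≠ 0 := by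
  have : NeZero k := ⟨w.hk.ne'⟩
  have hsc : ∀ n : ℕ, φ.SameCycle d (φ^[n] d) := fun n => ⟨n, by rw [zpow_natCast, Perm.iterate_eq_pow]⟩
  have hper := (h.rel hd).per
  have hm := h.hm
  have hmk : 2 * k ≤ m * k := Nat.mul_le_mul_right _ hm
  have hne : ∀ n < k, φ^[n] d ≠ φ^[n + k] d := by
    intro n hn he
    have := Function.iterate_injOn_Iio_minimalPeriod (f := φ) (x := d)
      (show n ∈ Set.Iio _ by simp only [Set.mem_Iio]; omega)
      (show n + k ∈ Set.Iio _ by simp only [Set.mem_Iio]; omega) he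
    have := w.hk
    omega
  cases hs : s d
  · refine ⟨φ^[(j d - f).val] d, φ^[(j d - f).val + k] d, hne _ (ZMod.val_lt _), hsc _, hsc _, ?_, ?_,
      (h.φi hd _).1, (h.φi hd _).1⟩
    · rw [(h.φi hd _).2.2.2 hs]; simp
    · rw [(h.φi hd _).2.2.2 hs]; simp
  · refine ⟨φ^[(f - j d).val] d, φ^[(f - j d).val + k] d, hne _ (ZMod.val_lt _), hsc _, hsc _, ?_, ?_,
      (h.φi hd _).1, (h.φi hd _).1⟩
    · rw [(h.φi hd _).2.2.1 hs]; simp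
    · rw [(h.φi hd _).2.2.1 hs]; simp

open Classical in
lemma not_bad [DecidableEq D] : 2 * dist (FI A φ) (T (α * φ) c) ≤ Mc ε := by
  have : NeZero k := ⟨w.hk.ne'⟩
  have hZI : ZS ε ≤ FI A φ := by
    intro f hf
    rw [mem_FI]
    intro d
    by_cases hd : ε d = 0
    · rw [(h.iso hd).1]
    · rw [hf d hd, hf _ (h.φR.2 hd)]
  have hZT : ZS ε ≤ T (α * φ) c := by
    intro f hf
    rw [mem_T_iff]
    refine ⟨fun d => ?_, 1, fun d hd => ?_⟩
    · by_cases hd : ε d = 0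
      · rw [Perm.mul_apply, (h.iso hd).1, h.hα.2.2 d hd]
      · rw [Perm.mul_apply, hf d hd, hf _ (h.αR.2 (h.φR.2 hd))]
    · have : ε d = 0 := by
        by_contra h'
        exact hd (hf d h')
      simp [(h.iso this).2.2]
  have hd := dist_le_ZS hZI hZT
  obtain ⟨fm, hfm⟩ := Finite.exists_min w.τ
  obtain ⟨fM, hfM⟩ := Finite.exists_max w.τ
  have hFB := h.F_le_B hfm hfM
  have hGB := h.GB_le
  have hI : 2 * finrank ℚ (FI A φ ⊓ KS ε : Submodule ℚ (D → ℚ)) ≤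
      ∑ d, if ε d ≠ 0 ∧ j d = fm then 1 else 0 := by
    apply count _ φ
    · intro f hf
      exact hf.1.1
    · intro f hf d hd
      have hd' : ε d ≠ 0 := fun h0 => hd (hf.2 d h0)
      obtain ⟨x, y, hxy, sx, sy, jx, jy, ex, ey⟩ := h.face_two hd' fm
      have hsub : ({x, y} : Finset D) ⊆ Finset.univ.filter (fun e => φ.SameCycle d e) := by
        intro z hz
        simp only [Finset.mem_insert, Finset.mem_singleton] at hz
        rcases hz with rfl | rfl <;> simp [sx, sy]
      refine le_trans ?_ (Finset.sum_le_sum_of_subset (fun z hz => by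
            have := hsub hz
            simpa using this))
      rw [Finset.sum_pair hxy]
      simp [jx, jy, ex, ey]
  have hT : 2 * finrank ℚ (T (α * φ) c ⊓ KS ε : Submodule ℚ (D → ℚ)) ≤
      ∑ d, ((if h.G d then 2 else 0) + (if h.B d then 1 else 0)) := by
    apply count _ (α * φ)
    · intro f hf
      exact hf.1.1
    · intro f hf d hd
      have hd' : ε d ≠ 0 := fun h0 => hd (hf.2 d h0)
      have ht := hf.1.2 d hd
      by_cases hG : ∃ e, (α * φ).SameCycle d e ∧ h.G e
      · obtain ⟨e, he, hGe⟩ := hG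
        have hsub : ({e} : Finset D) ⊆ Finset.univ.filter (fun e => (α * φ).SameCycle d e) := by
          intro z hz
          simp only [Finset.mem_singleton] at hz
          subst hz; simp [he]
        refine le_trans ?_ (Finset.sum_le_sum_of_subset (fun z hz => by
            have := hsub hz
            simpa using this))
        simp [hGe]
      · push Not at hG
        obtain ⟨h1, h2, h3⟩ := h.vertex2 hd' ht hG
        have hsub : ({d, (α * φ) d} : Finset D) ⊆
            Finset.univ.filter (fun e => (α * φ).SameCycle d e) := by
          intro z hz
          simp only [Finset.mem_insert, Finset.mem_singleton] at hz
          simp only [Finset.mem_filter, Finset.mem_univ, true_and]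
          rcases hz with rfl | rfl
          · exact SameCycle.refl _ _
          · exact sameCycle_apply_right.2 (SameCycle.refl _ _)
        refine le_trans ?_ (Finset.sum_le_sum_of_subset (fun z hz => by
            have := hsub hz
            simpa using this))
        rw [Finset.sum_pair h1.symm, if_pos h2, if_pos h3]
        omega
  rw [Finset.sum_add_distrib] at hT
  have e1 : ∑ d, (if ε d ≠ 0 ∧ j d = fm then 1 else 0) =
    (Finset.univ.filter (fun d => ε d ≠ 0 ∧ j d = fm)).card := by rw [Finset.card_filter]
  have e2 : ∑ d, (if h.G d then 2 else 0) = 2 * (Finset.univ.filter (fun d => h.G d)).card := by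
    rw [← Finset.sum_filter, Finset.sum_const, smul_eq_mul, mul_comm]
  have e3 : ∑ d, (if h.B d then 1 else 0) = (Finset.univ.filter (fun d => h.B d)).card := by
    rw [Finset.card_filter]
  rw [e1] at hI
  rw [e2, e3] at hT
  omega

end Ctx
end Pf

namespace Pf
open Equiv Equiv.Perm
section
variable {D A : Type} [Group A]

lemma tele {G : Type} [Group G] (t a : ℕ → G) (n : ℕ) :
    ((List.range n).map (fun i => (t (n - i))⁻¹ * (a (n - i - 1))⁻¹)).prod * a 0 *
      ((List.range n).map (fun i => t (i + 1) * a (i + 1))).prod = a n := by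
  induction n with
  | zero => simp
  | succ n ih =>
    nth_rewrite 1 [List.range_succ_eq_map]
    rw [List.range_succ]
    simp only [List.map_cons, List.map_map, List.prod_cons, List.map_append, List.prod_append,
      List.map_nil, List.prod_nil, Function.comp_def, Nat.succ_eq_add_one, Nat.add_sub_add_right,
      Nat.sub_zero, Nat.add_sub_cancel, mul_one]
    calc _ = (t (n + 1))⁻¹ * (a n)⁻¹ * (((List.range n).map
          (fun i => (t (n - i))⁻¹ * (a (n - i - 1))⁻¹)).prod * a 0 *
          ((List.range n).map (fun i => t (i + 1) * a (i + 1))).prod) * (t (n + 1) * a (n + 1)) := by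
            simp only [mul_assoc]
      _ = _ := by rw [ih]; group

lemma orb_chain {φ ψ : Perm D} {e : D} {rest : List D} (n : ℕ) : ∀ d : D,
    (∀ i < n, ψ (φ^[i] d) = φ^[i + 1] d) → ψ (φ^[n] d) = e →
    (e :: rest).IsChain (fun x y => ψ x = y) →
    ((List.range (n + 1)).map (fun i => φ^[i] d) ++ e :: rest).IsChain (fun x y => ψ x = y) := by
  induction n with
  | zero =>
    intro d h1 h2 h3
    simp only [zero_add, List.range_one, List.map_cons, List.map_nil, List.cons_append,
      List.nil_append]
    exact List.IsChain.cons_cons h2 h3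
  | succ n ih =>
    intro d h1 h2 h3
    have := ih (φ d) (fun i hi => by
      have := h1 (i + 1) (by omega)
      simpa [Function.iterate_succ_apply] using this) (by
      simpa [Function.iterate_succ_apply] using h2) h3
    rw [List.range_succ_eq_map]
    simp only [List.map_cons, List.map_map, Function.comp_def, Nat.succ_eq_add_one,
      Function.iterate_succ_apply, Function.iterate_zero, id_eq, List.cons_append]
    rw [List.range_succ_eq_map] at this ⊢
    simp only [List.map_cons, List.map_map, Function.comp_def, Nat.succ_eq_add_one,
      Function.iterate_succ_apply, Function.iterate_zero, id_eq, List.cons_append] at this ⊢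
    have h0 := h1 0 (by omega)
    simp only [Function.iterate_zero, id_eq, zero_add, Function.iterate_one] at h0
    exact List.IsChain.cons_cons h0 this

/-- transfer of the relator property -/
lemma IsRel.transfer {k : ℕ} {w : WD A k} {m : ℕ} {s : D → Bool} {j : D → ZMod k}
    {φ φ' : Perm D} {ε ε' : D → ℤ} {c c' : D → A} {X : D → Prop} {d : D}
    (h : IsRel w m s j φ ε c d) (hd : X d) (hX : ∀ e, X e → X (φ e))
    (hφ : ∀ e, X e → φ' e = φ e) (hε : ε' d = ε d) (hc : c' d = c d) :
    IsRel w m s j φ' ε' c' d := by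
  have hit : ∀ n, X (φ^[n] d) ∧ φ'^[n] d = φ^[n] d := by
    intro n
    induction n with
    | zero => exact ⟨hd, rfl⟩
    | succ n ih =>
      rw [Function.iterate_succ_apply', Function.iterate_succ_apply', ih.2]
      exact ⟨hX _ ih.1, hφ _ ih.1⟩
  refine ⟨?_, ?_, ?_, ?_⟩
  · rw [hφ _ hd]; exact h.hs
  · rw [hφ _ hd, hε, hc]; exact h.pos
  · rw [hφ _ hd, hε, hc]; exact h.neg
  · rw [← h.per, Function.minimalPeriod_eq_minimalPeriod_iff]
    intro n
    unfold Function.IsPeriodicPt Function.IsFixedPt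
    rw [(hit n).2]

end

variable {D A : Type} [Group A] [Fintype D] [DecidableEq D]

theorem thmT {k : ℕ} (w : WD A k) (m : ℕ) (hm : 2 ≤ m) (s : D → Bool) (j : D → ZMod k) (n : ℕ) :
    ∀ (φ : Perm D) (ε : D → ℤ) (c : D → A), Mc ε = n →
      (∀ d, IsIso φ ε c d ∨ IsRel w m s j φ ε c d) → ¬ Bad φ ε c := by
  induction n using Nat.strong_induction_on with
  | _ n ih =>
  rintro φ ε c hn hR ⟨α, hα, hlt⟩
  by_cases star : ∀ x, ε x ≠ 0 → j (α x) ≠ j x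
  · have := (Ctx.mk hm hR hα star : Ctx w m s j φ ε c α).not_bad
    omega
  push Not at star
  have hrel : ∀ d, ε d ≠ 0 → IsRel w m s j φ ε c d := fun d hd =>
    (hR d).resolve_left fun h' => hd h'.2.1
  have hsφ : ∀ d, s (φ d) = s d := by
    intro d
    rcases hR d with h' | h'
    · rw [h'.1]
    · exact h'.hs
  have hss : ∀ x, ε x ≠ 0 → j (α x) = j x → s (α x) = !(s x) := by
    intro x hx hj
    have hx' : ε (α x) ≠ 0 := by rw [hα.2.1]; omega
    have h1 := hrel x hx
    have h2 := hrel _ hx'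
    have h3 := hα.2.1 x
    cases hs : s x <;> cases hs' : s (α x) <;> simp
    · rw [(h1.neg hs).2.1, (h2.neg hs').2.1, hj] at h3
      have := w.ew_ne (j x); omega
    · rw [(h1.pos hs).2.1, (h2.pos hs').2.1, hj] at h3
      have := w.ew_ne (j x); omega
  obtain ⟨x, hx, hj, hs⟩ : ∃ x, ε x ≠ 0 ∧ j (α x) = j x ∧ s x = true := by
    obtain ⟨x, hx, hj⟩ := star
    cases hs : s x
    · refine ⟨α x, by rw [hα.2.1]; omega, by rw [hα.1, hj], ?_⟩
      rw [hss x hx hj, hs]; rfl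
    · exact ⟨x, hx, hj, hs⟩
  set y := α x with hy
  have hys : s y = false := by rw [hss x hx hj, hs]; rfl
  have hεy : ε y ≠ 0 := by rw [hα.2.1]; omega
  have hnsc : ¬ φ.SameCycle x y := by
    intro h
    have hit : ∀ n : ℕ, s ((φ ^ n) x) = s x := by
      intro n
      induction n with
      | zero => simp
      | succ n ih => rw [pow_succ', Perm.mul_apply, hsφ, ih]
    obtain ⟨i, -, -, hi⟩ := h.exists_pow_eq
    have := hit i
    rw [hi, hs, hys] at this
    exact absurd this (by simp)
  have hbad := bad_merge hα hlt hx hnsc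
  rw [← hy] at hbad
  obtain ⟨N, hN⟩ : ∃ N, m * k = N + 1 :=
    ⟨m * k - 1, by have := Nat.mul_pos (by omega : 0 < m) w.hk; omega⟩
  set φ' := swap x y * φ with hφ'
  set ε' := Function.update (Function.update ε x 0) y 0 with hε'
  let o : D → List D := fun d => (List.range (N + 1)).map (fun i => φ^[i] d)
  have ho : ∀ d, o d = d :: (List.range N).map (fun i => φ^[i + 1] d) := by
    intro d
    simp only [o]
    rw [List.range_succ_eq_map]
    simp [Function.comp_def, -Function.iterate_succ]
  have hperx : Function.minimalPeriod φ x = N + 1 := by rw [(hrel x hx).per, hN]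
  have hpery : Function.minimalPeriod φ y = N + 1 := by rw [(hrel y hεy).per, hN]
  have hlast : ∀ d, Function.minimalPeriod φ d = N + 1 → φ (φ^[N] d) = d := by
    intro d hd
    rw [← Function.iterate_succ_apply' φ N d, Nat.succ_eq_add_one, ← hd]
    exact Function.iterate_minimalPeriod
  have hinj : ∀ d, Function.minimalPeriod φ d = N + 1 → ∀ i i', i < N + 1 → i' < N + 1 →
      φ^[i] d = φ^[i'] d → i = i' := by
    intro d hd i i' hi hi' he
    exact Function.iterate_injOn_Iio_minimalPeriod (f := φ) (x := d) (by rw [hd]; exact hi)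
      (by rw [hd]; exact hi') he
  have hsco : ∀ d (i : ℕ), φ.SameCycle d (φ^[i] d) := fun d i =>
    ⟨i, by rw [zpow_natCast, Perm.iterate_eq_pow]⟩
  have hnd : ∀ d, Function.minimalPeriod φ d = N + 1 → (o d).Nodup := by
    intro d hd
    apply List.Nodup.map_on _ List.nodup_range
    intro i hi i' hi' he
    rw [List.mem_range] at hi hi'
    exact hinj d hd i i' hi hi' he
  have hcl : ∀ d, Function.minimalPeriod φ d = N + 1 → ∀ e, φ e ∈ o d → e ∈ o d := by
    intro d hd e he
    simp only [o, List.mem_map, List.mem_range] at he ⊢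
    obtain ⟨i, hi, he⟩ := he
    cases i with
    | zero =>
      refine ⟨N, by omega, ?_⟩
      apply φ.injective
      rw [hlast d hd, ← he]; rfl
    | succ i =>
      refine ⟨i, by omega, ?_⟩
      apply φ.injective
      rw [← he, Function.iterate_succ_apply']
  have hφ'e : ∀ e, φ e ≠ x → φ e ≠ y → φ' e = φ e := fun e h1 h2 => by
    rw [hφ', Perm.mul_apply, swap_apply_of_ne_of_ne h1 h2]
  set l := o y ++ o x with hl
  have hyl : y ∈ l := by rw [hl, ho y]; simp
  have hxl : x ∈ l := by rw [hl, ho x]; simp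
  have hlnd : l.Nodup := by
    rw [hl, List.nodup_append]
    refine ⟨hnd y hpery, hnd x hperx, ?_⟩
    intro a ha b hb hab
    subst hab
    simp only [o, List.mem_map] at ha hb
    obtain ⟨i, -, rfl⟩ := ha
    obtain ⟨i', -, he⟩ := hb
    have h1 := hsco x i'
    rw [he] at h1
    exact hnsc (h1.trans (hsco y i).symm)
  have hlcl : ∀ e, e ∉ l → φ e ∉ l := by
    intro e he he'
    apply he
    rw [hl, List.mem_append] at he' ⊢
    exact he'.imp (hcl y hpery e) (hcl x hperx e)
  have hiter : ∀ d d', Function.minimalPeriod φ d = N + 1 → ¬ φ.SameCycle d d' →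
      ∀ i < N, φ (φ^[i] d) ≠ d ∧ φ (φ^[i] d) ≠ d' := by
    intro d d' hd hdd i hi
    rw [← Function.iterate_succ_apply' φ i d]
    constructor
    · intro he
      have := hinj d hd (i + 1) 0 (by omega) (by omega) he
      omega
    · intro he
      exact hdd (he ▸ hsco d _)
  have hCl : Cl φ' y l := by
    unfold Cl
    rw [hl, List.append_assoc]
    have h2 : (o x ++ [y]).IsChain (fun a b => φ' a = b) := by
      apply orb_chain N x
      · intro i hi
        obtain ⟨h1, h2⟩ := hiter x y hperx hnsc i hi
        rw [hφ'e _ h1 h2, Function.iterate_succ_apply']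
      · rw [hφ', Perm.mul_apply, hlast x hperx, swap_apply_left]
      · simp
    rw [ho x, List.cons_append] at h2 ⊢
    refine orb_chain N y ?_ ?_ h2
    · intro i hi
      obtain ⟨h1, h2⟩ := hiter y x hpery (fun h => hnsc h.symm) i hi
      rw [hφ'e _ h2 h1, Function.iterate_succ_apply']
    · rw [hφ', Perm.mul_apply, hlast y hpery, swap_apply_right]
  have hφi : ∀ d, ε d ≠ 0 → ∀ n : ℕ, ε (φ^[n] d) ≠ 0 ∧ s (φ^[n] d) = s d ∧
      (s d = true → j (φ^[n] d) = j d + n) ∧ (s d = false → j (φ^[n] d) = j d - n) := by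
    intro d hd n
    have hRφ : ∀ d, ε d ≠ 0 → ε (φ d) ≠ 0 := by
      intro d h1 h2
      rcases hR (φ d) with h | h
      · have := φ.injective h.1
        rw [this] at h2
        exact h1 h2
      · exact h.ne h2
    induction n with
    | zero => simp [hd]
    | succ n ih =>
      rw [Function.iterate_succ_apply']
      have hr := hrel _ ih.1
      refine ⟨hRφ _ ih.1, by rw [hsφ, ih.2.1], fun hs => ?_, fun hs => ?_⟩
      · rw [(hr.pos (ih.2.1.trans hs)).1, ih.2.2.1 hs]; push_cast; ring
      · rw [(hr.neg (ih.2.1.trans hs)).1, ih.2.2.2 hs]; push_cast; ring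
  have hε'y : ε' y = 0 := by simp [hε']
  have hε'x : ε' x = 0 := by
    by_cases hxy : x = y
    · rw [hxy]; exact hε'y
    · simp [hε', hxy]
  have hε'e : ∀ e, e ≠ x → e ≠ y → ε' e = ε e := fun e h1 h2 => by simp [hε', h1, h2]
  have hεl : ∀ d ∈ l, ε' d = 0 ∨ ε' d = 1 ∨ ε' d = -1 := by
    intro d _
    by_cases h1 : d = x
    · left; rw [h1]; exact hε'x
    by_cases h2 : d = y
    · left; rw [h2]; exact hε'y
    rw [hε'e d h1 h2]
    rcases hR d with h | h
    · exact Or.inl h.2.1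
    · right
      cases hsd : s d
      · rw [(h.neg hsd).2.1]
        rcases w.hew (j d) with h | h <;> rw [h] <;> simp
      · rw [(h.pos hsd).2.1]
        exact w.hew _
  have hev : ev ε' c l = inl (1 : A) := by
    have key := tele (fun i : ℕ => (inr (Multiplicative.ofAdd (w.ew (j x + i))) : A ∗ Multiplicative ℤ))
      (fun i : ℕ => (inl (w.aw (j x + i)) : A ∗ Multiplicative ℤ)) N
    have hNz : ((N : ZMod k)) = -1 := by
      have : ((m * k : ℕ) : ZMod k) = ((N + 1 : ℕ) : ZMod k) := by rw [hN]
      push_cast at this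
      rw [ZMod.natCast_self, mul_zero] at this
      exact eq_neg_of_add_eq_zero_left this.symm
    have hX : ev ε' c ((List.range N).map (fun i => φ^[i + 1] x)) =
        ((List.range N).map (fun i => (inr (Multiplicative.ofAdd (w.ew (j x + ((i + 1 : ℕ) : ZMod k)))) *
          inl (w.aw (j x + ((i + 1 : ℕ) : ZMod k))) : A ∗ Multiplicative ℤ))).prod := by
      unfold ev
      rw [List.map_map]
      congr 1
      apply List.map_congr_left
      intro i hi
      rw [List.mem_range] at hi
      obtain ⟨h1, h2⟩ := hiter x y hperx hnsc i hi
      rw [← Function.iterate_succ_apply' φ i x] at h1 h2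
      obtain ⟨h3, h4, h5, -⟩ := hφi x hx (i + 1)
      have h6 := (hrel _ h3).pos (h4.trans hs)
      simp only [Function.comp, ltv]
      rw [hε'e _ h1 h2, h6.2.1, h6.2.2, h5 hs]
    have hY : ev ε' c ((List.range N).map (fun i => φ^[i + 1] y)) =
        ((List.range N).map (fun i =>
          (inr (Multiplicative.ofAdd (w.ew (j x + ((N - i : ℕ) : ZMod k)))) : A ∗ Multiplicative ℤ)⁻¹ *
          (inl (w.aw (j x + ((N - i - 1 : ℕ) : ZMod k))))⁻¹)).prod := by
      unfold ev
      rw [List.map_map]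
      congr 1
      apply List.map_congr_left
      intro i hi
      rw [List.mem_range] at hi
      obtain ⟨h2, h1⟩ := hiter y x hpery (fun h => hnsc h.symm) i hi
      rw [← Function.iterate_succ_apply' φ i y] at h1 h2
      obtain ⟨h3, h4, -, h5⟩ := hφi y hεy (i + 1)
      have h6 := (hrel _ h3).neg (h4.trans hys)
      have e1 : j x + ((N - i : ℕ) : ZMod k) = j x - ((i + 1 : ℕ) : ZMod k) := by
        rw [Nat.cast_sub hi.le, hNz]; push_cast; ring
      have e2 : j x + ((N - i - 1 : ℕ) : ZMod k) = j x - ((i + 1 : ℕ) : ZMod k) - 1 := by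
        rw [Nat.cast_sub (by omega), Nat.cast_sub hi.le, hNz]; push_cast; ring
      simp only [Function.comp, ltv]
      rw [hε'e _ h1 h2, h6.2.1, h6.2.2, h5 hys, e1, e2, hj, ofAdd_neg, map_inv, map_inv]
    rw [hl, ev_append, ho y, ho x, ev_cons, ev_cons, hX, hY]
    have c1 := ((hrel x hx).pos hs).2.2
    have c2 := ((hrel y hεy).neg hys).2.2
    rw [hε'x, hε'y, c1, c2, hj]
    simp only [Nat.cast_zero, add_zero, hNz] at key
    simp only [ltv, ofAdd_zero, map_one, one_mul, map_inv]
    rw [← sub_eq_add_neg] at key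
    rw [← key]
    group
  obtain ⟨φ'', ε'', c'', hiff, hin, hcb, hout⟩ := red (1 : A) y _ φ' ε' c l rfl hlnd
    (by rw [hl, ho y]; simp) hCl hε'y hεl hev
  have hbad' := hiff.1 hbad
  have hout' : ∀ d, d ∉ l → φ'' d = φ d ∧ ε'' d = ε d ∧ c'' d = c d := by
    intro d hd
    obtain ⟨h1, h2, h3⟩ := hout d hd
    have hφd := hlcl d hd
    refine ⟨?_, ?_, h3⟩
    · rw [h1, hφ'e]
      · intro h; exact hφd (h ▸ hxl)
      · intro h; exact hφd (h ▸ hyl)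
    · rw [h2, hε'e]
      · intro h; exact hd (h ▸ hxl)
      · intro h; exact hd (h ▸ hyl)
  have hlt' : Mc ε'' < n := by
    rw [← hn]
    apply Finset.card_lt_card
    rw [Finset.ssubset_iff_of_subset]
    · refine ⟨x, by simp [hx], by simp [(hin x hxl).2.1]⟩
    · intro d hd
      simp only [Finset.mem_filter, Finset.mem_univ, true_and] at hd ⊢
      have hdl : d ∉ l := fun h => hd (hin d h).2.1
      rw [← (hout' d hdl).2.1]; exact hd
  refine ih _ hlt' φ'' ε'' c'' rfl ?_ hbad'
  intro d
  by_cases hd : d ∈ l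
  · left
    refine ⟨(hin d hd).1, (hin d hd).2.1, ?_⟩
    by_cases hdy : d = y
    · rw [hdy, hcb]
    · exact (hin d hd).2.2 hdy
  · obtain ⟨h1, h2, h3⟩ := hout' d hd
    rcases hR d with h | h
    · left
      exact ⟨by rw [h1, h.1], by rw [h2, h.2.1], by rw [h3, h.2.2]⟩
    · right
      exact h.transfer (X := fun e => e ∉ l) hd hlcl (fun e he => (hout' e he).1) h2 h3

end Pf

namespace Pf
section
variable {A : Type} [Group A]

/-- product of a list of letters -/
noncomputable def PL (L : List (ℤ × A)) : A ∗ Multiplicative ℤ :=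
  (L.map (fun x => ltv A x.1 x.2)).prod

lemma PL_append (L M : List (ℤ × A)) : PL (L ++ M) = PL L * PL M := by simp [PL]
lemma PL_cons (x : ℤ × A) (M : List (ℤ × A)) : PL (x :: M) = ltv A x.1 x.2 * PL M := by simp [PL]
lemma PL_nil : PL ([] : List (ℤ × A)) = 1 := by simp [PL]

/-- all exponents are signs -/
def Sg (L : List (ℤ × A)) : Prop := ∀ x ∈ L, x.1 = 1 ∨ x.1 = -1

lemma p_ltv (e : ℤ) (a : A) : freeProdProj A (ltv A e a) = Multiplicative.ofAdd e := by
  simp [freeProdProj, ltv]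

lemma p_PL (L : List (ℤ × A)) :
    freeProdProj A (PL L) = Multiplicative.ofAdd (L.map Prod.fst).sum := by
  induction L with
  | nil => simp [PL_nil]
  | cons x L ih => rw [PL_cons, map_mul, ih, p_ltv, List.map_cons, List.sum_cons, ofAdd_add]

lemma PL_mul_inl (L : List (ℤ × A)) (hL : L ≠ []) (hs : Sg L) (a : A) :
    ∃ L', L'.length = L.length ∧ Sg L' ∧ PL L * inl a = PL L' := by
  obtain ⟨L0, ⟨e, b⟩, rfl⟩ := List.eq_nil_or_concat L |>.resolve_left hL
  refine ⟨L0 ++ [(e, b * a)], by simp, ?_, ?_⟩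
  · intro x hx
    simp only [List.concat_eq_append, List.mem_append, List.mem_singleton] at hx
    rcases hx with hx | rfl
    · exact hs x (by simp [hx])
    · exact hs (e, b) (by simp)
  · simp [PL, ltv, mul_assoc]

lemma conj_absorb (L : List (ℤ × A)) (hL : L ≠ []) (hs : Sg L) (a : A) :
    ∃ L', L'.length = L.length ∧ Sg L' ∧ IsConj (inl a * PL L) (PL L') := by
  obtain ⟨L', h1, h2, h3⟩ := PL_mul_inl L hL hs a
  refine ⟨L', h1, h2, ?_⟩
  rw [← h3, isConj_iff]
  exact ⟨(inl a)⁻¹, by group⟩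

lemma exists_PL (g : A ∗ Multiplicative ℤ) : ∃ a L, Sg L ∧ g = inl a * PL L := by
  have hmul : ∀ g h : A ∗ Multiplicative ℤ, (∃ a L, Sg L ∧ g = inl a * PL L) →
      (∃ a L, Sg L ∧ h = inl a * PL L) → ∃ a L, Sg L ∧ g * h = inl a * PL L := by
    rintro _ _ ⟨a, L, hL, rfl⟩ ⟨b, M, hM, rfl⟩
    by_cases h : L = []
    · subst h
      exact ⟨a * b, M, hM, by simp [PL_nil, mul_assoc]⟩
    · obtain ⟨L', -, h2, h3⟩ := PL_mul_inl L h hL b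
      refine ⟨a, L' ++ M, ?_, ?_⟩
      · intro x hx
        rcases List.mem_append.1 hx with hx | hx
        · exact h2 x hx
        · exact hM x hx
      · rw [PL_append, ← h3]; group
  induction g using Coprod.induction_on with
  | inl a => exact ⟨a, [], by simp [Sg], by simp [PL_nil]⟩
  | inr z =>
    obtain ⟨z, rfl⟩ := Multiplicative.ofAdd.surjective z
    have h1 : ∀ e : ℤ, e = 1 ∨ e = -1 → ∃ (a : A) (L : List (ℤ × A)), Sg L ∧
        (inr (Multiplicative.ofAdd e) : A ∗ Multiplicative ℤ) = inl a * PL L := fun e he =>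
      ⟨1, [(e, 1)], by simpa [Sg] using he, by simp [PL, ltv]⟩
    induction z using Int.induction_on with
    | zero => exact ⟨1, [], by simp [Sg], by simp [PL_nil]⟩
    | succ i ih =>
      rw [ofAdd_add, map_mul]
      exact hmul _ _ ih (h1 1 (Or.inl rfl))
    | pred i ih =>
      rw [sub_eq_add_neg, ofAdd_add, map_mul]
      exact hmul _ _ ih (h1 _ (Or.inr rfl))
  | mul x y hx hy => exact hmul _ _ hx hy

lemma conj_rotate (L : List (ℤ × A)) (n : ℕ) : IsConj (PL L) (PL (L.rotate n)) := by
  induction n with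
  | zero => rw [List.rotate_zero]
  | succ n ih =>
    refine ih.trans ?_
    rw [← List.rotate_rotate]
    generalize L.rotate n = M
    cases M with
    | nil => exact IsConj.refl _
    | cons x M =>
      rw [List.rotate_cons_succ, List.rotate_zero, PL_append, PL_cons, PL_cons, PL_nil, mul_one]
      rw [isConj_iff]
      exact ⟨(ltv A x.1 x.2)⁻¹, by group⟩

/-- value of the relator -/
noncomputable def WD.val {k : ℕ} (W : WD A k) : A ∗ Multiplicative ℤ :=
  ((List.range k).map (fun i : ℕ => ltv A (W.ew i) (W.aw i))).prod

theorem normalize (w : A ∗ Multiplicative ℤ) (hw : freeProdProj A w = Multiplicative.ofAdd 1) :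
    ∃ (k : ℕ) (W : WD A k), IsConj w W.val := by
  classical
  have hp : ∀ L : List (ℤ × A), IsConj w (PL L) → (L.map Prod.fst).sum = 1 := by
    intro L hL
    have := MonoidHom.map_isConj (freeProdProj A) hL
    rw [isConj_iff_eq, hw, p_PL] at this
    exact (Multiplicative.ofAdd.injective this).symm
  have hex : ∃ n, ∃ L : List (ℤ × A), L.length = n ∧ Sg L ∧ IsConj w (PL L) := by
    obtain ⟨a, L, hL, rfl⟩ := exists_PL w
    have hne : L ≠ [] := by
      rintro rfl
      rw [map_mul, p_PL] at hw
      simp [freeProdProj] at hw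
      exact absurd (Multiplicative.ofAdd.injective (hw : Multiplicative.ofAdd (0:ℤ) = Multiplicative.ofAdd 1)) (by norm_num)
    obtain ⟨L', h1, h2, h3⟩ := conj_absorb L hne hL a
    exact ⟨_, L', rfl, h2, h3⟩
  obtain ⟨L, hlen, hs, hconj⟩ := Nat.find_spec hex
  have hmin := fun n => Nat.find_min hex (m := n)
  generalize Nat.find hex = k at *
  have hsum := hp L hconj
  have hk : 0 < k := by
    rcases Nat.eq_zero_or_pos k with h | h
    · rw [h, List.length_eq_zero_iff] at hlen
      subst hlen
      simp at hsum
    · exact h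
  have : NeZero k := ⟨hk.ne'⟩
  have hlt : ∀ i : ZMod k, i.val < L.length := fun i => hlen ▸ ZMod.val_lt i
  let S : ℕ → ℤ := fun n => ((L.take n).map Prod.fst).sum
  have hS : ∀ n (h : n < L.length), S (n + 1) = S n + L[n].1 := by
    intro n h
    simp only [S]
    rw [List.take_succ_eq_append_getElem h, List.map_append, List.sum_append]
    simp only [List.map_cons, List.map_nil, List.sum_cons, List.sum_nil, add_zero]
  have hval : ∀ i : ZMod k, (i + 1).val = (i.val + 1) % k := by
    intro i
    rw [ZMod.val_add, ZMod.val_one_eq_one_mod]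
    simp
  let W : WD A k :=
    { ew := fun i => (L[i.val]'(hlt i)).1
      aw := fun i => (L[i.val]'(hlt i)).2
      C := fun i => i.val - k * S (i.val + 1)
      hk := hk
      hew := fun i => hs _ (List.getElem_mem _)
      hred := by
        intro i he ha
        set M := L.rotate i.val with hM
        have hMl : M.length = k := by rw [hM, List.length_rotate, hlen]
        have hMs : Sg M := fun x hx => hs x (List.mem_rotate.1 hx)
        have hMc : IsConj w (PL M) := hconj.trans (conj_rotate _ _)
        have h0 : ∀ h : 0 < M.length, M[0] = L[i.val]'(hlt i) := by
          intro h
          simp only [hM, List.getElem_rotate, zero_add, Nat.mod_eq_of_lt (hlt i)]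
        have h1 : ∀ h : 1 < M.length, M[1] = L[(i + 1).val]'(hlt _) := by
          intro h
          simp only [hM, List.getElem_rotate, hval, hlen, add_comm]
        match M, hMl, hMs, hMc, h0, h1 with
        | [], h, _, _, _, _ => simp at h; omega
        | [x], h, _, _, _, _ =>
          simp at h
          subst h
          have : i + 1 = i := Subsingleton.elim _ _
          rw [this] at he
          have := hs _ (List.getElem_mem (hlt i))
          omega
        | x :: y :: R, h, hMs, hMc, h0, h1 =>
          have h0 := h0 (by simp)
          have h1 := h1 (by simp)
          simp only [List.getElem_cons_zero, List.getElem_cons_succ] at h0 h1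
          rw [← h0, ← h1] at he
          rw [← h0] at ha
          have hsm := hp _ hMc
          simp only [List.map_cons, List.sum_cons] at hsm
          have hR : R ≠ [] := by
            rintro rfl
            simp at hsm
            omega
          have hPR : PL (x :: y :: R) = inl y.2 * PL R := by
            rw [PL_cons, PL_cons, ltv, ltv, he, ha, map_one, mul_one, ofAdd_neg, map_inv]
            group
          obtain ⟨R', r1, r2, r3⟩ := conj_absorb R hR
            (fun z hz => hMs z (by simp [hz])) y.2
          rw [← hPR] at r3
          refine hmin R.length ?_ ⟨R', r1, r2, hMc.trans r3⟩
          simp at h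
          omega
      hC := by
        intro i
        have e := hval i
        have hi := ZMod.val_lt i
        have hgoal : ∀ n (h : n < L.length), (i + 1).val = n → (n : ℤ) - k * S n = i.val - k * S (i.val + 1) + 1 →
            ((i + 1).val : ℤ) - k * S ((i + 1).val + 1) = i.val - k * S (i.val + 1) + 1 - k * (L[(i+1).val]'(hlt _)).1 := by
          intro n h hn h2
          subst hn
          rw [hS _ h]
          linear_combination h2
        by_cases h : i.val + 1 < k
        · rw [Nat.mod_eq_of_lt h] at e
          refine hgoal _ (by omega) e ?_
          push_cast; ring
        · have h' : i.val + 1 = k := by omega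
          rw [h', Nat.mod_self] at e
          refine hgoal 0 (by omega) e ?_
          rw [h']
          have : S k = 1 := by
            simp only [S]
            rw [← hlen, List.take_length, hsum]
          have h0 : S 0 = 0 := by simp [S]
          rw [this, h0]
          have : (i.val : ℤ) + 1 = k := by exact_mod_cast h'
          push_cast
          linarith
      hC0 := by
        intro i
        push_cast
        simp }
  refine ⟨k, W, ?_⟩
  convert hconj using 1
  unfold WD.val PL
  congr 1
  apply List.ext_getElem
  · simp [hlen]
  · intro n h1 h2
    simp only [List.length_map, List.length_range] at h1
    simp only [List.getElem_map, List.getElem_range, W]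
    have : ((n : ZMod k)).val = n := by rw [ZMod.val_natCast, Nat.mod_eq_of_lt h1]
    simp only [this]

end
end Pf

namespace Pf
open Equiv Equiv.Perm
section
variable {D A : Type} [Group A]

lemma Cl_get {φ : Perm D} {b : D} {l : List D} (hb : l.head? = some b) (h : Cl φ b l) (i : ℕ)
    (hi : i < l.length) :
    φ l[i] = l[(i + 1) % l.length]'(Nat.mod_lt _ (by omega)) := by
  unfold Cl at h
  rw [List.isChain_iff_getElem] at h
  have h1 := h i (by simp; omega)
  rw [List.getElem_append_left hi] at h1
  rw [h1]
  by_cases h2 : i + 1 < l.length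
  · rw [List.getElem_append_left h2]
    simp only [Nat.mod_eq_of_lt h2]
  · have h3 : i + 1 = l.length := by omega
    rw [List.getElem_append_right (by omega)]
    simp only [h3, Nat.mod_self, List.getElem_singleton]
    rw [List.head?_eq_getElem?] at hb
    rw [List.getElem?_eq_getElem (by omega)] at hb
    exact (Option.some.inj hb).symm

lemma Cl_closed {φ : Perm D} {b : D} {l : List D} (hb : l.head? = some b) (h : Cl φ b l) (d : D)
    (hd : d ∉ l) : φ d ∉ l := by
  intro hd'
  obtain ⟨i, hi, he⟩ := List.getElem_of_mem hd'
  apply hd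
  have h1 := Cl_get hb h ((i + (l.length - 1)) % l.length) (Nat.mod_lt _ (by omega))
  have h2 : ((i + (l.length - 1)) % l.length + 1) % l.length = i := by
    rw [Nat.mod_add_mod, show i + (l.length - 1) + 1 = i + l.length by omega, Nat.add_mod_right,
      Nat.mod_eq_of_lt hi]
  simp only [h2, he] at h1
  rw [← φ.injective h1]
  exact List.getElem_mem _

lemma Cl_iter {φ : Perm D} {b : D} {l : List D} (hb : l.head? = some b) (h : Cl φ b l) (i : ℕ)
    (hi : i < l.length) (n : ℕ) :
    φ^[n] l[i] = l[(i + n) % l.length]'(Nat.mod_lt _ (by omega)) := by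
  induction n with
  | zero => simp [Nat.mod_eq_of_lt hi]
  | succ n ih =>
    rw [Function.iterate_succ_apply', ih, Cl_get hb h]
    simp only [Nat.mod_add_mod, add_assoc]

lemma Cl_per {φ : Perm D} {b : D} {l : List D} (hnd : l.Nodup) (hb : l.head? = some b)
    (h : Cl φ b l) (i : ℕ) (hi : i < l.length) : Function.minimalPeriod φ l[i] = l.length := by
  have key : ∀ n, Function.IsPeriodicPt φ n l[i] ↔ l.length ∣ n := by
    intro n
    unfold Function.IsPeriodicPt Function.IsFixedPt
    rw [Cl_iter hb h i hi, hnd.getElem_inj_iff]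
    constructor
    · intro he
      have : i + n ≡ i + 0 [MOD l.length] := by
        unfold Nat.ModEq
        rw [he, add_zero, Nat.mod_eq_of_lt hi]
      exact (Nat.modEq_zero_iff_dvd).1 (Nat.ModEq.add_left_cancel' i this)
    · rintro ⟨q, rfl⟩
      rw [Nat.add_mul_mod_self_left, Nat.mod_eq_of_lt hi]
  apply Nat.dvd_antisymm
  · rw [← Function.isPeriodicPt_iff_minimalPeriod_dvd, key]
  · rw [← key]
    exact Function.isPeriodicPt_minimalPeriod _ _

lemma chain_sameCycle {φ : Perm D} {l : List D} : ∀ {x : D},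
    (x :: l).IsChain (fun a b => φ a = b) → ∀ y ∈ l, φ.SameCycle x y := by
  induction l with
  | nil => simp
  | cons z l ih =>
    intro x h y hy
    rw [List.isChain_cons_cons] at h
    have h1 : φ.SameCycle x z := by
      rw [← h.1]; exact sameCycle_apply_right.2 (SameCycle.refl _ _)
    rcases List.mem_cons.1 hy with rfl | hy
    · exact h1
    · exact h1.trans (ih h.2 y hy)

lemma pinch1 [DecidableEq D] {φ : Perm D} {b u v : D} {p r0 y : List D}
    (hnd : (p ++ [u] ++ (r0 ++ [v] ++ y)).Nodup) (hhd : (p ++ [u]).head? = some b)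
    (hcl : Cl φ b (p ++ [u] ++ (r0 ++ [v] ++ y))) :
    Cl (φ * swap u v) b (p ++ [u] ++ y) ∧
    (∃ r1, (r0 ++ [v]).head? = some r1 ∧ Cl (φ * swap u v) r1 (r0 ++ [v])) ∧
    φ.SameCycle u v ∧ u ≠ v := by
  unfold Cl at *
  rw [List.append_assoc, List.isChain_append, List.append_assoc (r0 ++ [v]),
    List.isChain_append (l₁ := r0 ++ [v])] at hcl
  obtain ⟨c1, ⟨c2, c3, c4⟩, c5⟩ := hcl
  have hsc : φ.SameCycle u v := by
    have : (u :: (r0 ++ [v])).IsChain (fun a b => φ a = b) := by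
      rw [← List.singleton_append, List.isChain_append]
      refine ⟨by simp, c2, ?_⟩
      intro x hx z hz
      simp at hx
      subst hx
      apply c5 _ (by simp)
      rw [List.head?_append_of_ne_nil _ (by simp)]
      exact hz
    exact chain_sameCycle this v (by simp)
  rw [List.nodup_append] at hnd
  obtain ⟨n1, n2, n3⟩ := hnd
  rw [List.nodup_append] at n1 n2
  obtain ⟨n4, -, n5⟩ := n1
  obtain ⟨n6, n7, n8⟩ := n2
  rw [List.nodup_append] at n6
  have huv : u ≠ v := n3 u (by simp) v (by simp)
  have hφ' : ∀ a, a ≠ u → a ≠ v → (φ * swap u v) a = φ a := by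
    intro a h1 h2
    rw [Perm.mul_apply, swap_apply_of_ne_of_ne h1 h2]
  have d1 : (p ++ [u]).IsChain (fun a b => (φ * swap u v) a = b) :=
    chain_congr (fun a ha => hφ' a (n5 a ha u (by simp)) (n3 a (by simp [ha]) v (by simp))) c1
  have d2 : (r0 ++ [v]).IsChain (fun a b => (φ * swap u v) a = b) :=
    chain_congr (fun a ha => hφ' a (fun h => n3 u (by simp) a (by simp [ha]) h.symm)
      (n6.2.2 a ha v (by simp))) c2
  have d3 : (y ++ [b]).IsChain (fun a b => (φ * swap u v) a = b) :=
    chain_congr (fun a ha => hφ' a (fun h => n3 u (by simp) a (by simp [ha]) h.symm)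
      (fun h => n8 v (by simp) a ha h.symm)) c3
  refine ⟨?_, ?_, hsc, huv⟩
  · rw [List.append_assoc, List.isChain_append]
    refine ⟨d1, d3, ?_⟩
    intro x hx z hz
    simp at hx
    subst hx
    rw [Perm.mul_apply, swap_apply_left]
    exact c4 v (by simp) z hz
  · obtain ⟨r1, hr1⟩ : ∃ r1, (r0 ++ [v]).head? = some r1 := by
      cases r0 <;> simp
    refine ⟨r1, hr1, ?_⟩
    rw [List.isChain_append]
    refine ⟨d2, by simp, ?_⟩
    intro x hx z hz
    simp at hx hz
    subst hx; subst hz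
    rw [Perm.mul_apply, swap_apply_right]
    apply c5 u (by simp)
    rw [List.head?_append_of_ne_nil _ (by simp), hr1]
    rfl

/-- labels -/
abbrev Lt (A : Type) (k : ℕ) := ℤ × A × Bool × ZMod k

/-- value of a label list -/
noncomputable def va {k : ℕ} (Λ : List (Lt A k)) : A ∗ Multiplicative ℤ :=
  (Λ.map (fun x => ltv A x.1 x.2.1)).prod

lemma va_append {k : ℕ} (Λ M : List (Lt A k)) : va (Λ ++ M) = va Λ * va M := by simp [va]

/-- positive relator -/
def posL {k : ℕ} (w : WD A k) (m : ℕ) : List (Lt A k) :=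
  (List.range (m * k)).map (fun i : ℕ => (w.ew i, w.aw i, true, (i : ZMod k)))

/-- negative relator -/
def negL {k : ℕ} (w : WD A k) (m : ℕ) : List (Lt A k) :=
  (List.range (m * k)).map
    (fun i : ℕ => (-w.ew (-1 - i), (w.aw (-1 - i - 1))⁻¹, false, (-1 - i : ZMod k)))

/-- flattening of blocks -/
def flat {k : ℕ} (Bs : List (List (Lt A k) × List (Lt A k) × List (Lt A k))) : List (Lt A k) :=
  Bs.flatMap (fun B => B.1 ++ (B.2.1 ++ B.2.2))

lemma isRel_of_Cl {k : ℕ} {w : WD A k} {m : ℕ} (hm : 2 ≤ m) {lab : D → Lt A k} {φ : Perm D}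
    {r1 : D} {r : List D} (hnd : r.Nodup) (hb : r.head? = some r1) (h : Cl φ r1 r)
    (hr : r.map lab = posL w m ∨ r.map lab = negL w m) (d : D) (hd : d ∈ r) :
    IsRel w m (fun d => (lab d).2.2.1) (fun d => (lab d).2.2.2) φ (fun d => (lab d).1)
      (fun d => (lab d).2.1) d := by
  have hlen : r.length = m * k := by
    rcases hr with hr | hr <;> have := congrArg List.length hr <;> simpa [posL, negL] using this
  obtain ⟨i, hi, rfl⟩ := List.getElem_of_mem hd
  have hcast : (((i + 1) % r.length : ℕ) : ZMod k) = i + 1 := by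
    rw [hlen, show (i : ZMod k) + 1 = ((i + 1 : ℕ) : ZMod k) by push_cast; rfl,
      ZMod.natCast_eq_natCast_iff]
    exact (Nat.mod_modEq (i + 1) (m * k)).of_dvd (Nat.dvd_mul_left k m)
  have hgen : ∀ F : ℕ → Lt A k, r.map lab = (List.range (m * k)).map F →
      ∀ (i : ℕ) (hi : i < r.length), lab r[i] = F i := by
    intro F hF i hi
    have h1 : (r.map lab)[i]? = ((List.range (m * k)).map F)[i]? := by rw [hF]
    rw [hlen] at hi
    simpa [hi, hlen] using h1
  have hp := Cl_per hnd hb h i hi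
  rcases hr with hr | hr
  · have h1 := hgen _ hr
    have h2 := h1 i hi
    have h3 := h1 ((i + 1) % r.length) (Nat.mod_lt _ (by omega))
    rw [← Cl_get hb h i hi] at h3
    refine ⟨?_, ?_, ?_, ?_⟩
    · simp only [h2, h3]
    · intro _
      simp only [h2, h3, hcast, true_and, and_self]
    · intro hs
      simp only [h2] at hs
      exact absurd hs (by simp)
    · rw [hp, hlen]
  · have h1 := hgen _ hr
    have h2 := h1 i hi
    have h3 := h1 ((i + 1) % r.length) (Nat.mod_lt _ (by omega))
    rw [← Cl_get hb h i hi] at h3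
    refine ⟨?_, ?_, ?_, ?_⟩
    · simp only [h2, h3]
    · intro hs
      simp only [h2] at hs
      exact absurd hs (by simp)
    · intro _
      simp only [h2, h3, hcast]
      refine ⟨by ring, trivial, trivial⟩
    · rw [hp, hlen]

end
variable {D A : Type} [Group A] [Fintype D] [DecidableEq D]

lemma ev_lab {k : ℕ} (lab : D → Lt A k) (l : List D) :
    ev (fun d => (lab d).1) (fun d => (lab d).2.1) l = va (l.map lab) := by
  simp [ev, va, Function.comp_def]

lemma pinch_all {k : ℕ} {w : WD A k} {m : ℕ} (hm : 2 ≤ m) (lab : D → Lt A k) (b : D)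
    (Bs : List (List (Lt A k) × List (Lt A k) × List (Lt A k))) :
    ∀ (φ : Perm D) (l1 l2 : List D), (l1 ++ l2).Nodup → l1.head? = some b → Cl φ b (l1 ++ l2) →
    Bad φ (fun d => (lab d).1) (fun d => (lab d).2.1) → l2.map lab = flat Bs →
    (∀ B ∈ Bs, (B.2.1 = posL w m ∨ B.2.1 = negL w m) ∧ va B.1 * va B.2.2 = 1) →
    (∀ d, d ∉ l1 ++ l2 → IsRel w m (fun d => (lab d).2.2.1) (fun d => (lab d).2.2.2) φ
      (fun d => (lab d).1) (fun d => (lab d).2.1) d) →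
    ∃ (φ' : Perm D) (l' : List D), l'.Nodup ∧ l'.head? = some b ∧ Cl φ' b l' ∧
      Bad φ' (fun d => (lab d).1) (fun d => (lab d).2.1) ∧
      va (l'.map lab) = va (l1.map lab) ∧
      ∀ d, d ∉ l' → IsRel w m (fun d => (lab d).2.2.1) (fun d => (lab d).2.2.2) φ'
        (fun d => (lab d).1) (fun d => (lab d).2.1) d := by
  induction Bs with
  | nil =>
    intro φ l1 l2 hnd hhd hcl hbad hl2 _ hrel
    simp [flat] at hl2
    subst hl2
    rw [List.append_nil] at *
    exact ⟨φ, l1, hnd, hhd, hcl, hbad, rfl, hrel⟩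
  | cons B Bs ih =>
    intro φ l1 l2 hnd hhd hcl hbad hl2 hB hrel
    have hfl : flat (B :: Bs) = B.1 ++ (B.2.1 ++ (B.2.2 ++ flat Bs)) := by simp [flat]
    rw [hfl, List.map_eq_append_iff] at hl2
    obtain ⟨g, t, rfl, hg, ht⟩ := hl2
    rw [List.map_eq_append_iff] at ht
    obtain ⟨r, t, rfl, hr, ht⟩ := ht
    rw [List.map_eq_append_iff] at ht
    obtain ⟨h, q, rfl, hh, hq⟩ := ht
    obtain ⟨hB1, hB2⟩ := hB B (by simp)
    have hrne : r ≠ [] := by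
      rintro rfl
      have hlen : B.2.1.length = m * k := by
        rcases hB1 with h | h <;> rw [h] <;> simp [posL, negL]
      rw [← hr] at hlen
      have := Nat.mul_pos (by omega : 0 < m) w.hk
      rw [List.map_nil, List.length_nil] at hlen
      omega
    have hpne : l1 ++ g ≠ [] := by
      intro h
      simp at h
      rw [h.1] at hhd
      simp at hhd
    obtain ⟨r0, v, hr0⟩ := (List.eq_nil_or_concat r).resolve_left hrne
    obtain ⟨p, u, hpu⟩ := (List.eq_nil_or_concat (l1 ++ g)).resolve_left hpne
    rw [List.concat_eq_append] at hr0 hpu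
    have hfull : l1 ++ (g ++ (r ++ (h ++ q))) = p ++ [u] ++ (r0 ++ [v] ++ (h ++ q)) := by
      rw [← hpu, ← hr0]; simp
    have hhd' : (p ++ [u]).head? = some b := by
      rw [← hpu]
      rw [List.head?_append, hhd]; rfl
    have hhd2 : (l1 ++ g ++ h).head? = some b := by
      rw [List.append_assoc, List.head?_append, hhd]; rfl
    rw [hfull] at hnd hcl hrel
    obtain ⟨k1, ⟨r1, k2, k3⟩, k4, k5⟩ := pinch1 hnd hhd' hcl
    have hbad' := bad_pinch k5 k4 hbad
    have hndr : (r0 ++ [v]).Nodup := by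
      rw [List.nodup_append] at hnd
      have := hnd.2.1
      rw [List.nodup_append] at this
      exact this.1
    have hnd' : (p ++ [u] ++ (h ++ q)).Nodup := by
      refine List.Nodup.sublist ?_ hnd
      exact List.Sublist.append (List.Sublist.refl _) (List.sublist_append_right _ _)
    have e1 : l1 ++ g ++ h ++ q = p ++ [u] ++ (h ++ q) := by rw [← hpu]; simp
    have hrel' : ∀ d, d ∉ l1 ++ g ++ h ++ q → IsRel w m (fun d => (lab d).2.2.1)
        (fun d => (lab d).2.2.2) (φ * swap u v) (fun d => (lab d).1) (fun d => (lab d).2.1) d := by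
      intro d hd
      by_cases hdr : d ∈ r0 ++ [v]
      · refine isRel_of_Cl hm hndr k2 k3 ?_ d hdr
        rw [← hr0, hr]
        exact hB1
      · have hd' : d ∉ p ++ [u] ++ (r0 ++ [v] ++ (h ++ q)) := by
          rw [e1] at hd
          simp only [List.mem_append] at hd hdr ⊢
          tauto
        refine (hrel d hd').transfer (X := fun e => e ∉ p ++ [u] ++ (r0 ++ [v] ++ (h ++ q))) hd'
          ?_ ?_ rfl rfl
        · exact fun e he => Cl_closed (by rw [List.head?_append, hhd']; rfl) hcl e he
        · intro e he
          rw [Perm.mul_apply, swap_apply_of_ne_of_ne]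
          · rintro rfl; apply he; simp
          · rintro rfl; apply he; simp
    obtain ⟨φ', l', a1, a2, a3, a4, a5, a6⟩ := ih (φ * swap u v) (l1 ++ g ++ h) q
      (by rw [e1]; exact hnd') hhd2 (by rw [e1]; exact k1) hbad' hq
      (fun B' hB' => hB B' (by simp [hB'])) hrel'
    refine ⟨φ', l', a1, a2, a3, a4, ?_, a6⟩
    rw [a5]
    simp only [List.map_append, va_append, hg, hh]
    rw [mul_assoc, hB2, mul_one]

theorem no_label {k : ℕ} {w : WD A k} {m : ℕ} (hm : 2 ≤ m) (lab : D → Lt A k) (b : D)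
    (Bs : List (List (Lt A k) × List (Lt A k) × List (Lt A k))) (φ : Perm D) (l2 : List D)
    (hnd : (b :: l2).Nodup) (hall : ∀ d, d ∈ b :: l2) (hcl : Cl φ b (b :: l2))
    (hl2 : l2.map lab = flat Bs)
    (hB : ∀ B ∈ Bs, (B.2.1 = posL w m ∨ B.2.1 = negL w m) ∧ va B.1 * va B.2.2 = 1)
    (hb0 : (lab b).1 = 0) (hb1 : (lab b).2.1 = 1)
    (hε : ∀ d, (lab d).1 = 0 ∨ (lab d).1 = 1 ∨ (lab d).1 = -1)
    (a : A) (hev : va (flat Bs) = inl a) : a = 1 := by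
  by_contra ha
  have hvb : ∀ l : List D, va ((b :: l).map lab) = va (l.map lab) := by
    intro l
    simp [va, hb0, hb1, ltv]
  have hbad : Bad φ (fun d => (lab d).1) (fun d => (lab d).2.1) := by
    obtain ⟨φ', ε', c', hiff, hin, hcb, -⟩ := red a b _ φ (fun d => (lab d).1)
      (fun d => (lab d).2.1) (b :: l2) rfl hnd rfl hcl hb0 (fun d _ => hε d)
      (by rw [ev_lab, hvb, hl2, hev])
    rw [hiff]
    have hφ' : φ' = 1 := by ext d; exact (hin d (hall d)).1
    have hε' : ∀ d, ε' d = 0 := fun d => (hin d (hall d)).2.1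
    refine ⟨1, ⟨fun _ => rfl, fun d => by simp [hε'], fun _ _ => rfl⟩, ?_⟩
    have hM : Mc ε' = 0 := by simp [Mc, hε']
    rw [hM, hφ', one_mul]
    have h1 : FI A (1 : Perm D) = ⊤ := by
      rw [eq_top_iff]
      intro f _
      exact mem_FI.2 fun d => rfl
    rw [h1]
    have h2 : T (1 : Perm D) c' ≠ ⊤ := by
      intro h
      have h3 : (fun _ => 1 : D → ℚ) ∈ T (1 : Perm D) c' := h ▸ trivial
      rw [mem_T_iff] at h3
      obtain ⟨-, g, hg⟩ := h3
      have := hg b (by simp)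
      rw [hcb] at this
      simp at this
      exact ha this
    have h4 := Submodule.finrank_lt h2
    unfold dist
    rw [top_inf_eq, finrank_top]
    have : (Module.finrank ℚ (T (1 : Perm D) c') : ℤ) < Module.finrank ℚ (D → ℚ) := by
      exact_mod_cast h4
    push_cast
    omega
  obtain ⟨φ', l', a1, a2, a3, a4, a5, a6⟩ := pinch_all hm lab b Bs φ [b] l2 hnd rfl hcl hbad hl2 hB
    (fun d hd => absurd (hall d) hd)
  have h5 : va (l'.map lab) = inl (1 : A) := by
    rw [a5, hvb]; simp [va]
  obtain ⟨φ'', ε'', c'', hiff, hin, hcb, hout⟩ := red (1 : A) b _ φ' (fun d => (lab d).1)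
      (fun d => (lab d).2.1) l' rfl a1 a2 a3 hb0 (fun d _ => hε d) (by rw [ev_lab, h5])
  refine thmT w m hm (fun d => (lab d).2.2.1) (fun d => (lab d).2.2.2) _ φ'' ε'' c'' rfl ?_
    (hiff.1 a4)
  intro d
  by_cases hd : d ∈ l'
  · left
    refine ⟨(hin d hd).1, (hin d hd).2.1, ?_⟩
    by_cases hdb : d = b
    · rw [hdb, hcb]
    · exact (hin d hd).2.2 hdb
  · right
    obtain ⟨h1, h2, h3⟩ := hout d hd
    exact (a6 d hd).transfer (X := fun e => e ∉ l') hd (fun e he => Cl_closed a2 a3 e he)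
      (fun e he => (hout e he).1) h2 h3

end Pf

namespace Pf
open Equiv Equiv.Perm
section
variable {A : Type} [Group A]

lemma va_posL {k : ℕ} (w : WD A k) (m : ℕ) : va (posL w m) = w.val ^ m := by
  induction m with
  | zero => simp [va, posL]
  | succ m ih =>
    rw [pow_succ, ← ih]
    unfold va posL WD.val
    rw [Nat.succ_mul, List.range_add]
    simp [Function.comp_def]

lemma va_negL {k : ℕ} (w : WD A k) (m : ℕ) :
    va (negL w m) = inl (w.aw (-1)) * (w.val ^ m)⁻¹ * (inl (w.aw (-1)))⁻¹ := by
  rw [← va_posL]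
  have key := tele
    (fun i : ℕ => (inr (Multiplicative.ofAdd (w.ew (-1 + i))) : A ∗ Multiplicative ℤ))
    (fun i : ℕ => (inl (w.aw (-1 + i)) : A ∗ Multiplicative ℤ)) (m * k)
  have hN : ((m * k : ℕ) : ZMod k) = 0 := by push_cast; simp
  have h1 : va (posL w m) = ((List.range (m * k)).map (fun i : ℕ =>
      (inr (Multiplicative.ofAdd (w.ew (-1 + ((i + 1 : ℕ) : ZMod k)))) *
        inl (w.aw (-1 + ((i + 1 : ℕ) : ZMod k))) : A ∗ Multiplicative ℤ))).prod := by
    unfold va posL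
    rw [List.map_map]
    congr 1
    apply List.map_congr_left
    intro i _
    have : (-1 + ((i + 1 : ℕ) : ZMod k)) = i := by push_cast; ring
    rw [this]
    rfl
  have h2 : va (negL w m) = ((List.range (m * k)).map (fun i : ℕ =>
      ((inr (Multiplicative.ofAdd (w.ew (-1 + ((m * k - i : ℕ) : ZMod k)))))⁻¹ *
        (inl (w.aw (-1 + ((m * k - i - 1 : ℕ) : ZMod k))))⁻¹ : A ∗ Multiplicative ℤ))).prod := by
    unfold va negL
    rw [List.map_map]
    congr 1
    apply List.map_congr_left
    intro i hi
    rw [List.mem_range] at hi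
    have e1 : (-1 + ((m * k - i : ℕ) : ZMod k)) = -1 - i := by
      rw [Nat.cast_sub hi.le, hN]; ring
    have e2 : (-1 + ((m * k - i - 1 : ℕ) : ZMod k)) = -1 - i - 1 := by
      rw [Nat.cast_sub (by omega), Nat.cast_sub hi.le, hN]; push_cast; ring
    rw [e1, e2]
    simp [ltv]
  rw [← h1, ← h2] at key
  simp only [hN, Nat.cast_zero, add_zero] at key
  rw [eq_mul_inv_iff_mul_eq, eq_mul_inv_iff_mul_eq, key]

lemma exists_lt (k : ℕ) (g : A ∗ Multiplicative ℤ) : ∃ Λ : List (Lt A k), va Λ = g ∧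
    ∀ x ∈ Λ, x.1 = 0 ∨ x.1 = 1 ∨ x.1 = -1 := by
  obtain ⟨a, L, hL, rfl⟩ := exists_PL g
  refine ⟨(0, a, true, 0) :: L.map (fun x => (x.1, x.2, true, 0)), ?_, ?_⟩
  · simp [va, PL, ltv, Function.comp_def]
  · intro x hx
    simp only [List.mem_cons, List.mem_map] at hx
    rcases hx with rfl | ⟨y, hy, rfl⟩
    · left; rfl
    · right; exact hL y hy

lemma exists_blocks {k : ℕ} (w : WD A k) (m : ℕ) (x : A ∗ Multiplicative ℤ)
    (hx : x ∈ Subgroup.normalClosure {w.val ^ m}) :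
    ∃ Bs : List (List (Lt A k) × List (Lt A k) × List (Lt A k)),
      (∀ B ∈ Bs, (B.2.1 = posL w m ∨ B.2.1 = negL w m) ∧ va B.1 * va B.2.2 = 1) ∧
      (∀ y ∈ flat Bs, y.1 = 0 ∨ y.1 = 1 ∨ y.1 = -1) ∧ va (flat Bs) = x := by
  have hone : ∀ (g : A ∗ Multiplicative ℤ) (R : List (Lt A k)), (R = posL w m ∨ R = negL w m) →
      ∃ B : List (Lt A k) × List (Lt A k) × List (Lt A k),
      ((B.2.1 = posL w m ∨ B.2.1 = negL w m) ∧ va B.1 * va B.2.2 = 1) ∧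
      (∀ y ∈ B.1 ++ (B.2.1 ++ B.2.2), y.1 = 0 ∨ y.1 = 1 ∨ y.1 = -1) ∧
      va (B.1 ++ (B.2.1 ++ B.2.2)) = g * va R * g⁻¹ := by
    intro g R hR
    obtain ⟨G, hG, hG'⟩ := exists_lt k g
    obtain ⟨H, hH, hH'⟩ := exists_lt k g⁻¹
    refine ⟨(G, R, H), ⟨hR, by simp [hG, hH]⟩, ?_, by simp [va_append, hG, hH, mul_assoc]⟩
    intro y hy
    simp only [List.mem_append] at hy
    rcases hy with hy | hy | hy
    · exact hG' y hy
    · rcases hR with rfl | rfl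
      · simp only [posL, List.mem_map] at hy
        obtain ⟨i, -, rfl⟩ := hy
        exact Or.inr (w.hew _)
      · simp only [negL, List.mem_map] at hy
        obtain ⟨i, -, rfl⟩ := hy
        right
        rcases w.hew (-1 - i) with h | h <;> simp [h]
    · exact hH' y hy
  have hx' : x ∈ (Subgroup.closure (Group.conjugatesOfSet {w.val ^ m})).toSubmonoid := hx
  rw [Subgroup.closure_toSubmonoid] at hx'
  obtain ⟨l, hl, rfl⟩ := Submonoid.exists_list_of_mem_closure hx'
  clear hx hx'
  induction l with
  | nil => exact ⟨[], by simp, by simp [flat], by simp [flat, va]⟩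
  | cons z l ih =>
    obtain ⟨Bs, b1, b2, b3⟩ := ih (fun y hy => hl y (List.mem_cons_of_mem _ hy))
    have hz : ∃ (g : A ∗ Multiplicative ℤ) (R : List (Lt A k)), (R = posL w m ∨ R = negL w m) ∧
        z = g * va R * g⁻¹ := by
      rcases hl z (by simp) with h | h
      · rw [Group.mem_conjugatesOfSet_iff] at h
        obtain ⟨_, rfl, h⟩ := h
        rw [isConj_iff] at h
        obtain ⟨g, hg⟩ := h
        exact ⟨g, _, Or.inl rfl, by rw [va_posL, hg]⟩
      · rw [Set.mem_inv, Group.mem_conjugatesOfSet_iff] at h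
        obtain ⟨_, rfl, h⟩ := h
        rw [isConj_iff] at h
        obtain ⟨g, hg⟩ := h
        refine ⟨g * (inl (w.aw (-1)))⁻¹, _, Or.inr rfl, ?_⟩
        rw [va_negL, ← inv_inj, ← hg]
        group
    obtain ⟨g, R, hR, hz⟩ := hz
    obtain ⟨B, c1, c2, c3⟩ := hone g R hR
    have hfl : flat (B :: Bs) = (B.1 ++ (B.2.1 ++ B.2.2)) ++ flat Bs := by simp [flat]
    refine ⟨B :: Bs, ?_, ?_, ?_⟩
    · intro B' hB'
      rcases List.mem_cons.1 hB' with rfl | h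
      · exact c1
      · exact b1 _ h
    · intro y hy
      rw [hfl, List.mem_append] at hy
      exact hy.elim (c2 y) (b2 y)
    · rw [hfl, va_append, c3, b3, List.prod_cons, hz]

theorem main_WD {k : ℕ} (w : WD A k) (m : ℕ) (hm : 2 ≤ m) (a : A)
    (h : (inl a : A ∗ Multiplicative ℤ) ∈ Subgroup.normalClosure {w.val ^ m}) : a = 1 := by
  obtain ⟨Bs, h1, h2, h3⟩ := exists_blocks w m _ h
  let Λ : List (Lt A k) := flat Bs
  let lab : Fin (Λ.length + 1) → Lt A k := Fin.cons (0, 1, true, 0) Λ.get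
  refine no_label hm lab 0 Bs (finRotate (Λ.length + 1)) ((List.finRange Λ.length).map Fin.succ)
    ?_ ?_ ?_ ?_ h1 rfl rfl ?_ a h3
  · rw [← List.finRange_succ]; exact List.nodup_finRange _
  · intro d
    rw [← List.finRange_succ]; exact List.mem_finRange d
  · rw [← List.finRange_succ]
    unfold Cl
    rw [List.isChain_iff_getElem]
    intro i hi
    simp only [List.length_append, List.length_finRange, List.length_singleton] at hi
    rw [List.getElem_append_left (by simp; omega)]
    by_cases h : i + 1 < Λ.length + 1
    · rw [List.getElem_append_left (by simp; omega)]
      simp only [List.getElem_finRange]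
      apply Fin.ext
      rw [coe_finRotate_of_ne_last]
      · simp
      · intro h'
        have := congrArg Fin.val h'
        simp at this
        omega
    · rw [List.getElem_append_right (by simp; omega)]
      have hi' : i = Λ.length := by omega
      subst hi'
      simp only [List.getElem_finRange, List.getElem_singleton]
      exact finRotate_last
  · rw [List.map_map]
    have : lab ∘ Fin.succ = Λ.get := by
      ext1 i
      simp [lab]
    rw [this, List.map_get_finRange]
  · intro d
    refine Fin.cases ?_ ?_ d
    · left; rfl
    · intro i
      simp only [lab, Fin.cons_succ]
      exact h2 _ (List.get_mem _ _)

lemma normalClosure_conj {G : Type} [Group G] {x y : G} (h : IsConj x y) :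
    Subgroup.normalClosure {x} ≤ Subgroup.normalClosure {y} := by
  apply Subgroup.normalClosure_le_normal
  intro z hz
  rw [Set.mem_singleton_iff] at hz
  subst hz
  rw [isConj_comm, isConj_iff] at h
  obtain ⟨g, rfl⟩ := h
  exact (Subgroup.normalClosure_normal).conj_mem _
    (Subgroup.subset_normalClosure (Set.mem_singleton y)) g

lemma main_pos (w : A ∗ Multiplicative ℤ) (hw : freeProdProj A w = Multiplicative.ofAdd 1)
    (m : ℕ) (hm : 2 ≤ m) (a : A)
    (h : (inl a : A ∗ Multiplicative ℤ) ∈ Subgroup.normalClosure {w ^ m}) : a = 1 := by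
  obtain ⟨k, W, hc⟩ := normalize w hw
  exact main_WD W m hm a (normalClosure_conj (hc.pow m) h)

end
end Pf

/-- For an arbitrary group `A` and `w ∈ A ∗ ℤ` with `p w = ±1`, the natural map
`A → (A ∗ ℤ)/⟪w^m⟫` is injective for every `m ≥ 2`. -/
theorem stmt1 {A : Type} [Group A]
    (w : A ∗ Multiplicative ℤ)
    (hw : freeProdProj A w = Multiplicative.ofAdd 1 ∨
          freeProdProj A w = Multiplicative.ofAdd (-1))
    (m : ℕ) (hm : 2 ≤ m) :
    Function.Injective
      ((QuotientGroup.mk' (Subgroup.normalClosure {w ^ m})).comp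
        (Coprod.inl : A →* A ∗ Multiplicative ℤ)) := by
  rw [injective_iff_map_eq_one]
  intro a ha
  rw [MonoidHom.comp_apply, QuotientGroup.mk'_apply, QuotientGroup.eq_one_iff] at ha
  rcases hw with hw | hw
  · exact Pf.main_pos w hw m hm a ha
  · refine Pf.main_pos w⁻¹ (by rw [map_inv, hw]; rfl) m hm a ?_
    have hle : Subgroup.normalClosure {w ^ m} ≤ Subgroup.normalClosure {w⁻¹ ^ m} := by
      apply Subgroup.normalClosure_le_normal
      intro z hz
      rw [Set.mem_singleton_iff] at hz
      subst hz
      have := (Subgroup.normalClosure {w⁻¹ ^ m}).inv_mem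
        (Subgroup.subset_normalClosure (Set.mem_singleton _))
      simpa using this
    exact hle ha
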